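/- arXiv:2006.04789 — 3 statements merged into one kernel-verified Lean document; each statement's English description precedes it below -/
import Mathlib

section
/- Let (R, S) and (R', S') be left and right noetherian rings with Ore sets of non-zero-divisors, both satisfying Assumption (⋆), and let π: R → R' be a ring homomorphism such that for every M ∈ 𝓒_{R,S} one has R' ⊗_R M ∈ 𝓒_{R',S'} and Tor_1^R(R', M) = 0. Let 𝓕_R: 𝓒_{R,S} → Ω_R and 𝓕_{R'}: 𝓒_{R',S'} → Ω_{R'} be quasi-Fitting invariants and ϖ: Ω_R → Ω_{R'} a monoid homomorphism such that ϖ(𝓕_R(M)) = 𝓕_{R'}(R' ⊗_R M) for all M ∈ 𝓒_{R,S}. Then ϖ(𝓕_R^⟨n⟩(M)) = 𝓕_{R'}^⟨n⟩(R' ⊗_R M) for every M ∈ 𝓒_{R,S} and every n ∈ ℤ. -/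
open CategoryTheory MulOpposite

noncomputable section

/-- `M` is `S`-torsion: every element is annihilated by some element of `S`. -/
def STorsion (R : Type) [Ring R] (S : Submonoid R) (M : Type) [AddCommGroup M] [Module R M] :
    Prop :=
  ∀ m : M, ∃ s ∈ S, s • m = 0

/-- Projective dimension `≤ n`, witnessed by resolutions with finite free stages. -/
def PdLE (R : Type) [Ring R] : ℕ → (M : Type) → [AddCommGroup M] → [Module R M] → Prop
  | 0, M, _, _ => Module.Projective R M
  | n+1, M, _, _ => ∃ (k : ℕ) (f : (Fin k → R) →ₗ[R] M),
      Function.Surjective f ∧ PdLE R n (LinearMap.ker f)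

/-- Finite projective dimension. -/
def FinitePd (R : Type) [Ring R] (M : Type) [AddCommGroup M] [Module R M] : Prop :=
  ∃ n, PdLE R n M

/-- Membership in the category `𝓜` of finitely generated `S`-torsion modules. -/
def MemM (R : Type) [Ring R] (S : Submonoid R) (M : Type) [AddCommGroup M] [Module R M] : Prop :=
  Module.Finite R M ∧ STorsion R S M

/-- Membership in `𝓟`: finitely generated `S`-torsion of projective dimension `≤ 1`. -/
def MemP (R : Type) [Ring R] (S : Submonoid R) (M : Type) [AddCommGroup M] [Module R M] : Prop :=
  MemM R S M ∧ PdLE R 1 M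

/-- Membership in `𝓠`: finitely generated `S`-torsion of finite projective dimension. -/
def MemQ (R : Type) [Ring R] (S : Submonoid R) (M : Type) [AddCommGroup M] [Module R M] : Prop :=
  MemM R S M ∧ FinitePd R M

/-- The Ext group `Ext^i_R(M, N)`. -/
abbrev extGroup (R : Type) [Ring R] (M N : Type) [AddCommGroup M] [Module R M]
    [AddCommGroup N] [Module R N] (i : ℕ) : Type :=
  (((_root_.Ext ℤ (ModuleCat R) i).obj (Opposite.op (ModuleCat.of R M))).obj (ModuleCat.of R N))

/-- Vanishing of `Ext^i_R(M, R)`. -/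
def ExtRVanish (R : Type) [Ring R] (M : Type) [AddCommGroup M] [Module R M] (i : ℕ) : Prop :=
  Subsingleton (extGroup R M R i)

/-- `pd*_R(M) ≤ 1`, i.e. `Ext^i_R(M, R) = 0` for all `i ≥ 2`. -/
def PdStarLE1 (R : Type) [Ring R] (M : Type) [AddCommGroup M] [Module R M] : Prop :=
  ∀ i, 2 ≤ i → ExtRVanish R M i

/-- Membership in `𝓒`: finitely generated `S`-torsion with `pd* ≤ 1`. -/
def MemC (R : Type) [Ring R] (S : Submonoid R) (M : Type) [AddCommGroup M] [Module R M] : Prop :=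
  MemM R S M ∧ PdStarLE1 R M

/-- Assumption (⋆): a uniform bound `d(R)` on `pd*` of all finitely generated left or
right `R`-modules. -/
def AssumptionStar (R : Type) [Ring R] : Prop :=
  ∃ d : ℕ,
    (∀ (M : Type) [AddCommGroup M] [Module R M], Module.Finite R M →
      ∀ i, d < i → ExtRVanish R M i) ∧
    (∀ (M : Type) [AddCommGroup M] [Module Rᵐᵒᵖ M], Module.Finite Rᵐᵒᵖ M →
      ∀ i, d < i → ExtRVanish Rᵐᵒᵖ M i)

/-- `S` is a (left and right) Ore set consisting of non-zero-divisors. -/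
def IsOreSet (R : Type) [Ring R] (S : Submonoid R) : Prop :=
  S ≤ nonZeroDivisors R ∧
    (∀ f ∈ S, ∀ a : R, ∃ r : R, ∃ s ∈ S, f * r = a * s) ∧
    (∀ f ∈ S, ∀ a : R, ∃ r : R, ∃ s ∈ S, r * f = s * a)

/-- A sequence of `R`-modules and maps, used to encode finite exact sequences. -/
structure ModSeq (R : Type) [Ring R] where
  C : ℕ → Type
  [acg : ∀ i, AddCommGroup (C i)]
  [mod : ∀ i, Module R (C i)]
  f : ∀ i, C i →ₗ[R] C (i+1)

attribute [instance] ModSeq.acg ModSeq.mod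

/-- `D.ExactTrunc n` : the window `0 → C 0 → C 1 → ⋯ → C (n+1) → 0` is exact. -/
def ModSeq.ExactTrunc {R : Type} [Ring R] (D : ModSeq R) (n : ℕ) : Prop :=
  Function.Injective (D.f 0) ∧ Function.Surjective (D.f n) ∧
    ∀ i < n, Function.Exact (D.f i) (D.f (i+1))

/-- The (initial) Fitting ideal of a module over a commutative ring. -/
def fittingIdeal (R : Type) [CommRing R] (M : Type) [AddCommGroup M] [Module R M] : Ideal R :=
  Ideal.span { x : R | ∃ (a : ℕ) (A : Matrix (Fin a) (Fin a) R) (π : (Fin a → R) →ₗ[R] M),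
    Function.Surjective π ∧ (∀ j, π (fun i => A i j) = 0) ∧ x = A.det }

/-- The Fitting ideal viewed as a fractional ideal, i.e. a finitely generated
`R`-submodule of `S⁻¹R`. -/
def fittFrac (R : Type) [CommRing R] (S : Submonoid R) (M : Type) [AddCommGroup M]
    [Module R M] : Submodule R (Localization S) :=
  Submodule.map (Algebra.linearMap R (Localization S)) (fittingIdeal R M)

/-- Precomposition with `ι`, as a map of right `R`-modules `Hom(F, R) → Hom(N, R)`. -/
def precompDual (R : Type) [Ring R] {N F : Type} [AddCommGroup N] [Module R N]
    [AddCommGroup F] [Module R F] (ι : N →ₗ[R] F) :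
    (F →ₗ[R] R) →ₗ[Rᵐᵒᵖ] (N →ₗ[R] R) where
  toFun g := g.comp ι
  map_add' _ _ := LinearMap.ext fun _ => rfl
  map_smul' _ _ := LinearMap.ext fun _ => rfl

/-- `Ext^1_R(M, R)` computed from a presentation `0 → N → F → M → 0` with `F` projective:
the cokernel of `Hom(F, R) → Hom(N, R)`; it is a right `R`-module. -/
abbrev ExtOneDual (R : Type) [Ring R] {N F : Type} [AddCommGroup N] [Module R N]
    [AddCommGroup F] [Module R F] (ι : N →ₗ[R] F) : Type :=
  (N →ₗ[R] R) ⧸ LinearMap.range (precompDual R ι)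

/-- Precomposition with `ι`, commutative case. -/
def precompDualComm (R : Type) [CommRing R] {N F : Type} [AddCommGroup N] [Module R N]
    [AddCommGroup F] [Module R F] (ι : N →ₗ[R] F) :
    (F →ₗ[R] R) →ₗ[R] (N →ₗ[R] R) where
  toFun g := g.comp ι
  map_add' _ _ := LinearMap.ext fun _ => rfl
  map_smul' _ _ := LinearMap.ext fun _ => rfl

/-- `Ext^1_R(M, R)` computed from a presentation, commutative case. -/
abbrev ExtOneDualComm (R : Type) [CommRing R] {N F : Type} [AddCommGroup N] [Module R N]
    [AddCommGroup F] [Module R F] (ι : N →ₗ[R] F) : Type :=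
  (N →ₗ[R] R) ⧸ LinearMap.range (precompDualComm R ι)

/-- A Fitting invariant `𝓕 : 𝓜 → Ω`. -/
def IsFittingInv (R : Type) [Ring R] (S : Submonoid R) {Ω : Type} [CommMonoid Ω]
    (F : (M : Type) → [AddCommGroup M] → [Module R M] → Ω) : Prop :=
  (∀ (P : Type) [AddCommGroup P] [Module R P], MemP R S P → IsUnit (F P)) ∧
  (∀ (M' M P : Type) [AddCommGroup M'] [Module R M'] [AddCommGroup M] [Module R M]
      [AddCommGroup P] [Module R P], MemM R S M' → MemM R S M → MemP R S P →
    ∀ (ι : M' →ₗ[R] M) (p : M →ₗ[R] P), Function.Injective ι → Function.Surjective p →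
      Function.Exact ι p → F M = F P * F M')

/-- A quasi-Fitting invariant `𝓕 : 𝓒 → Ω`. -/
def IsQuasiFittingInv (R : Type) [Ring R] (S : Submonoid R) {Ω : Type} [CommMonoid Ω]
    (F : (M : Type) → [AddCommGroup M] → [Module R M] → Ω) : Prop :=
  (∀ (P : Type) [AddCommGroup P] [Module R P], MemP R S P → IsUnit (F P)) ∧
  (∀ (M' M P : Type) [AddCommGroup M'] [Module R M'] [AddCommGroup M] [Module R M]
      [AddCommGroup P] [Module R P], MemC R S M' → MemC R S M → MemP R S P →
    ∀ (ι : M' →ₗ[R] M) (p : M →ₗ[R] P), Function.Injective ι → Function.Surjective p →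
      Function.Exact ι p → F M = F P * F M') ∧
  (∀ (P M M' : Type) [AddCommGroup P] [Module R P] [AddCommGroup M] [Module R M]
      [AddCommGroup M'] [Module R M'], MemP R S P → MemC R S M → MemC R S M' →
    ∀ (ι : P →ₗ[R] M) (p : M →ₗ[R] M'), Function.Injective ι → Function.Surjective p →
      Function.Exact ι p → F M = F P * F M')

/-- The membership predicate of `𝓜` as a family. -/
def MemMFam (R : Type) [Ring R] (S : Submonoid R) (M : Type) [AddCommGroup M] [Module R M] :
    Prop :=
  MemM R S M

/-- The membership predicate of `𝓒` as a family. -/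
def MemCFam (R : Type) [Ring R] (S : Submonoid R) (M : Type) [AddCommGroup M] [Module R M] :
    Prop :=
  MemC R S M

/-- `ω` is the value obtained from an exact sequence `0 → N → P₁ → ⋯ → Pₙ → M → 0`
(`n ≥ 0`), with all terms satisfying `Mem`, each `Pᵢ ∈ 𝓟`, via the formula
`ω = (∏ i, 𝓕(Pᵢ)^((-1)^i)) · 𝓕(N)`; inverses are recorded by witnesses `u`. -/
def PosShiftValue (R : Type) [Ring R] (S : Submonoid R) {Ω : Type} [CommMonoid Ω]
    (Mem : (M : Type) → [AddCommGroup M] → [Module R M] → Prop)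
    (F : (M : Type) → [AddCommGroup M] → [Module R M] → Ω) (n : ℕ)
    (M : Type) [AddCommGroup M] [Module R M] (ω : Ω) : Prop :=
  ∃ D : ModSeq R, D.ExactTrunc n ∧ Nonempty (D.C (n+1) ≃ₗ[R] M) ∧
    (∀ i, i ≤ n+1 → Mem (D.C i)) ∧ (∀ i, 1 ≤ i → i ≤ n → MemP R S (D.C i)) ∧
    ∃ u : ℕ → Ω, (∀ i, 1 ≤ i → i ≤ n → F (D.C i) * u i = 1) ∧
      ω = (∏ i ∈ Finset.range n, if (i+1) % 2 = 1 then u (i+1) else F (D.C (i+1))) * F (D.C 0)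

/-- `ω` is the value obtained from an exact sequence `0 → M → P_m → ⋯ → P₁ → N → 0`
(`m ≥ 1` corresponding to the shift `n = -m < 0`) via the formula
`ω = (∏ i, 𝓕(Pᵢ)^((-1)^i)) · 𝓕(N)`. -/
def NegShiftValue (R : Type) [Ring R] (S : Submonoid R) {Ω : Type} [CommMonoid Ω]
    (Mem : (M : Type) → [AddCommGroup M] → [Module R M] → Prop)
    (F : (M : Type) → [AddCommGroup M] → [Module R M] → Ω) (m : ℕ)
    (M : Type) [AddCommGroup M] [Module R M] (ω : Ω) : Prop :=
  ∃ D : ModSeq R, D.ExactTrunc m ∧ Nonempty (D.C 0 ≃ₗ[R] M) ∧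
    (∀ i, i ≤ m+1 → Mem (D.C i)) ∧ (∀ i, 1 ≤ i → i ≤ m → MemP R S (D.C i)) ∧
    ∃ u : ℕ → Ω, (∀ i, 1 ≤ i → i ≤ m → F (D.C i) * u i = 1) ∧
      ω = (∏ i ∈ Finset.range m, if (i+1) % 2 = 1 then u (m-i) else F (D.C (m-i))) * F (D.C (m+1))

/-- `ω` is the value of the `n`-th shift (`n ∈ ℤ`) of `F` at `M` computed from some
admissible exact sequence whose terms satisfy `Mem`. -/
def ShiftValue (R : Type) [Ring R] (S : Submonoid R) {Ω : Type} [CommMonoid Ω]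
    (Mem : (M : Type) → [AddCommGroup M] → [Module R M] → Prop)
    (F : (M : Type) → [AddCommGroup M] → [Module R M] → Ω) (n : ℤ)
    (M : Type) [AddCommGroup M] [Module R M] (ω : Ω) : Prop :=
  if 0 ≤ n then PosShiftValue R S Mem F n.toNat M ω else NegShiftValue R S Mem F (-n).toNat M ω

/-- The axioms for the family of shifts `{𝓕⁽ⁿ⁾ : 𝓜 → Ω}` of a quasi-Fitting invariant. -/
def IsShiftFamily (R : Type) [Ring R] (S : Submonoid R) {Ω : Type} [CommMonoid Ω]
    (F : (M : Type) → [AddCommGroup M] → [Module R M] → Ω)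
    (G : ℤ → (M : Type) → [AddCommGroup M] → [Module R M] → Ω) : Prop :=
  (∀ (M : Type) [AddCommGroup M] [Module R M], MemC R S M → G 0 M = F M) ∧
  (∀ (n : ℤ) (P : Type) [AddCommGroup P] [Module R P], MemQ R S P → IsUnit (G n P)) ∧
  (∀ (n : ℤ) (N P M : Type) [AddCommGroup N] [Module R N] [AddCommGroup P] [Module R P]
      [AddCommGroup M] [Module R M], MemM R S N → MemQ R S P → MemM R S M →
    ∀ (ι : N →ₗ[R] P) (p : P →ₗ[R] M), Function.Injective ι → Function.Surjective p →
      Function.Exact ι p → G n M = G n P * G (n-1) N) ∧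
  (∀ (n : ℤ) (M' M P : Type) [AddCommGroup M'] [Module R M'] [AddCommGroup M] [Module R M]
      [AddCommGroup P] [Module R P], MemM R S M' → MemM R S M → MemQ R S P →
    ∀ (ι : M' →ₗ[R] M) (p : M →ₗ[R] P), Function.Injective ι → Function.Surjective p →
      Function.Exact ι p → G n M = G n P * G n M') ∧
  (∀ (n : ℤ) (P M M' : Type) [AddCommGroup P] [Module R P] [AddCommGroup M] [Module R M]
      [AddCommGroup M'] [Module R M'], MemQ R S P → MemM R S M → MemM R S M' →
    ∀ (ι : P →ₗ[R] M) (p : M →ₗ[R] M'), Function.Injective ι → Function.Surjective p →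
      Function.Exact ι p → G n M = G n P * G n M')

end

/-- `ιB : M →ₛₗ[π] B` exhibits the `R'`-module `B` as the base change `R' ⊗_R M` of the
`R`-module `M` along `π : R →+* R'` (universal property). -/
def IsBaseChangeAlong {R R' : Type} [Ring R] [Ring R'] (π : R →+* R')
    (M : Type) [AddCommGroup M] [Module R M]
    (B : Type) [AddCommGroup B] [Module R' B] (ιB : M →ₛₗ[π] B) : Prop :=
  ∀ (X : Type) [AddCommGroup X] [Module R' X], ∀ g : M →ₛₗ[π] X,
    ∃! h : B →ₗ[R'] X, ∀ m, h (ιB m) = g m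

/-- `Tor_1^R(R', M) = 0`: for every presentation `0 → N → F → M → 0` with `F` finite free,
the induced map of base changes `R' ⊗_R N → R' ⊗_R F` is injective. -/
def TorOneVanish {R R' : Type} [Ring R] [Ring R'] (π : R →+* R')
    (M : Type) [AddCommGroup M] [Module R M] : Prop :=
  ∀ (k : ℕ) (N : Type) [AddCommGroup N] [Module R N]
    (ι : N →ₗ[R] (Fin k → R)) (p : (Fin k → R) →ₗ[R] M),
    Function.Injective ι → Function.Surjective p → Function.Exact ι p →
  ∀ (BN : Type) [AddCommGroup BN] [Module R' BN] (ιN : N →ₛₗ[π] BN),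
    IsBaseChangeAlong π N BN ιN →
  ∀ (BF : Type) [AddCommGroup BF] [Module R' BF] (ιF : (Fin k → R) →ₛₗ[π] BF),
    IsBaseChangeAlong π (Fin k → R) BF ιF →
  ∀ h : BN →ₗ[R'] BF, (∀ x, h (ιN x) = ιF (ι x)) → Function.Injective h

/-- `0 → A → B → C → 0` is a short exact sequence of modules. -/
structure IsShortExactSeq {R A B C : Type} [Ring R] [AddCommGroup A] [Module R A]
    [AddCommGroup B] [Module R B] [AddCommGroup C] [Module R C]
    (f : A →ₗ[R] B) (g : B →ₗ[R] C) : Prop where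
  inj : Function.Injective f
  surj : Function.Surjective g
  exact : Function.Exact f g

section ExtVanishing

variable {R : Type} [Ring R]

theorem extRVanish_iff (M : Type) [AddCommGroup M] [Module R M] (i : ℕ) :
    ExtRVanish R M (i + 1) ↔
      Subsingleton (Abelian.Ext (ModuleCat.of R M) (ModuleCat.of R R) (i + 1)) := by
  let P := projectiveResolution (ModuleCat.of R M)
  have h1 : ExtRVanish R M (i + 1) ↔
      ∀ f : P.complex.X (i + 1) ⟶ ModuleCat.of R R, P.complex.d (i + 2) (i + 1) ≫ f = 0 →
        ∃ g : P.complex.X i ⟶ ModuleCat.of R R, P.complex.d (i + 1) i ≫ g = f := by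
    rw [ExtRVanish, ModuleCat.isZero_iff_subsingleton.symm,
      (P.isoExt (R := ℤ) (i + 1) (ModuleCat.of R R)).isZero_iff,
      ← HomologicalComplex.exactAt_iff_isZero_homology,
      HomologicalComplex.exactAt_iff' _ i (i + 1) (i + 2) (by simp) (by simp),
      ShortComplex.moduleCat_exact_iff]
    rfl
  rw [h1]
  constructor
  · intro h
    refine subsingleton_of_forall_eq 0 fun x => ?_
    obtain ⟨f, hf, rfl⟩ := P.extMk_surjective x (i + 2) rfl
    exact (P.extMk_eq_zero_iff f (i + 2) rfl hf i rfl).2 (h f hf)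
  · intro h f hf
    exact (P.extMk_eq_zero_iff f (i + 2) rfl hf i rfl).1 (Subsingleton.elim _ _)

theorem pdStarLE1_iff (M : Type) [AddCommGroup M] [Module R M] :
    PdStarLE1 R M ↔ ∀ i, 2 ≤ i →
      ∀ x : Abelian.Ext (ModuleCat.of R M) (ModuleCat.of R R) i, x = 0 := by
  refine forall_congr' fun i => forall_congr' fun hi => ?_
  obtain ⟨i, rfl⟩ := Nat.exists_eq_add_of_le' (le_trans one_le_two hi)
  rw [extRVanish_iff]
  exact ⟨fun _ x => Subsingleton.elim _ _, fun h => subsingleton_of_forall_eq 0 h⟩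

variable {A B C : Type} [AddCommGroup A] [Module R A] [AddCommGroup B] [Module R B]
  [AddCommGroup C] [Module R C] {f : A →ₗ[R] B} {g : B →ₗ[R] C}

/-- The short complex in `ModuleCat` attached to a short exact sequence. -/
@[reducible] def IsShortExactSeq.toShortComplex (h : IsShortExactSeq f g) :
    ShortComplex (ModuleCat R) :=
  ShortComplex.mk (ModuleCat.ofHom f) (ModuleCat.ofHom g)
    (by ext x; exact h.exact.apply_apply_eq_zero x)

theorem IsShortExactSeq.shortExact (h : IsShortExactSeq f g) : h.toShortComplex.ShortExact where
  exact := (ShortComplex.ShortExact.moduleCat_exact_iff_function_exact _).2 h.exact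
  mono_f := (ModuleCat.mono_iff_injective _).2 h.inj
  epi_g := (ModuleCat.epi_iff_surjective _).2 h.surj

theorem IsShortExactSeq.pdStarLE1_left (h : IsShortExactSeq f g) (hB : PdStarLE1 R B)
    (hC : PdStarLE1 R C) : PdStarLE1 R A := by
  rw [pdStarLE1_iff] at *
  intro i hi x
  obtain ⟨y, rfl⟩ := Abelian.Ext.contravariant_sequence_exact₁ h.shortExact _ x (add_comm 1 i)
    (hC _ (by lia) _)
  rw [hB i hi y, Abelian.Ext.comp_zero]

theorem IsShortExactSeq.pdStarLE1_middle (h : IsShortExactSeq f g) (hA : PdStarLE1 R A)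
    (hC : PdStarLE1 R C) : PdStarLE1 R B := by
  rw [pdStarLE1_iff] at *
  intro i hi x
  obtain ⟨y, rfl⟩ := Abelian.Ext.contravariant_sequence_exact₂ h.shortExact _ x (hA i hi _)
  rw [hC i hi y, Abelian.Ext.comp_zero]

/-- A finitely generated projective module is built from `R` by a finite dual basis, so `Ext` into
it vanishes as soon as `Ext` into `R` does. -/
theorem ext_eq_zero_of_finite_projective {Y : ModuleCat.{0} R} {i : ℕ}
    (hY : ∀ x : Abelian.Ext Y (ModuleCat.of R R) i, x = 0)
    (L : Type) [AddCommGroup L] [Module R L] [Module.Finite R L] [Module.Projective R L]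
    (x : Abelian.Ext Y (ModuleCat.of R L) i) : x = 0 := by
  obtain ⟨n, p, hp⟩ := Module.Finite.exists_fin' R L
  obtain ⟨s, hs⟩ := Module.projective_lifting_property p LinearMap.id hp
  have hid : 𝟙 (ModuleCat.of R L) = ∑ j : Fin n,
      ModuleCat.ofHom ((LinearMap.proj j).comp s) ≫
        ModuleCat.ofHom (p.comp (LinearMap.single R (fun _ => R) j)) := by
    ext l
    have h1 : p (s l) = l := LinearMap.congr_fun hs l
    conv_lhs => rw [ModuleCat.id_apply, ← h1, ← LinearMap.sum_single_apply (fun _ => R) (s l)]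
    simp [ModuleCat.hom_sum]
  rw [← x.comp_mk₀_id, hid, Abelian.Ext.mk₀_sum, Abelian.Ext.comp_sum]
  refine Finset.sum_eq_zero fun j _ => ?_
  rw [← Abelian.Ext.mk₀_comp_mk₀, ← Abelian.Ext.comp_assoc_of_third_deg_zero,
    hY (Abelian.Ext.comp _ _ _), Abelian.Ext.zero_comp]

/-- Maps out of a syzygy of a module with `pd* ≤ 1` lift along extensions by a module of
projective dimension at most one. -/
theorem exists_lift_of_pdStarLE1 [IsNoetherianRing R]
    {Y F K P Q X : Type} [AddCommGroup Y] [Module R Y] [AddCommGroup F] [Module R F]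
    [AddCommGroup K] [Module R K] [AddCommGroup P] [Module R P] [AddCommGroup Q] [Module R Q]
    [AddCommGroup X] [Module R X] [Module.Projective R F]
    {y : Y →ₗ[R] F} {k : F →ₗ[R] K} (hY : IsShortExactSeq y k) (hK : PdStarLE1 R K)
    (hP : PdLE R 1 P) {a : P →ₗ[R] Q} {b : Q →ₗ[R] X} (hQ : IsShortExactSeq a b)
    (t : Y →ₗ[R] X) : ∃ s : Y →ₗ[R] Q, b.comp s = t := by
  rw [pdStarLE1_iff] at hK
  obtain ⟨n, q, hq, hL⟩ := hP
  have hL : Module.Projective R (LinearMap.ker q) := hL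
  have hres : IsShortExactSeq (LinearMap.ker q).subtype q :=
    ⟨Subtype.val_injective, hq, LinearMap.exact_subtype_ker_map q⟩
  have hF : Projective (ModuleCat.of R F) := (IsProjective.iff_projective F).1 inferInstance
  have hYR : ∀ i, 1 ≤ i → ∀ x : Abelian.Ext (ModuleCat.of R Y) (ModuleCat.of R R) i, x = 0 := by
    intro i hi x
    obtain ⟨i, rfl⟩ := Nat.exists_eq_add_of_le' hi
    obtain ⟨z, rfl⟩ := Abelian.Ext.contravariant_sequence_exact₁ hY.shortExact _ x
      (add_comm 1 (i + 1)) (hK _ (by lia) _)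
    rw [Abelian.Ext.eq_zero_of_projective z, Abelian.Ext.comp_zero]
  have hYP : ∀ x : Abelian.Ext (ModuleCat.of R Y) (ModuleCat.of R P) 1, x = 0 := by
    intro x
    obtain ⟨z, rfl⟩ := Abelian.Ext.covariant_sequence_exact₃ _ hres.shortExact x
      (one_add_one_eq_two) (ext_eq_zero_of_finite_projective (hYR 2 one_le_two) _ _)
    rw [ext_eq_zero_of_finite_projective (hYR 1 le_rfl) _ z, Abelian.Ext.zero_comp]
  obtain ⟨z, hz⟩ := Abelian.Ext.covariant_sequence_exact₃ _ hQ.shortExact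
    (Abelian.Ext.mk₀ (ModuleCat.ofHom t)) (zero_add 1) (hYP _)
  obtain ⟨s, rfl⟩ := (Abelian.Ext.mk₀_bijective _ _).2 z
  rw [Abelian.Ext.mk₀_comp_mk₀] at hz
  refine ⟨s.hom, ?_⟩
  exact congrArg ModuleCat.Hom.hom ((Abelian.Ext.mk₀_bijective _ _).1 hz)

theorem pdLE_one_iff [IsNoetherianRing R] (M : Type) [AddCommGroup M] [Module R M]
    [Module.Finite R M] :
    PdLE R 1 M ↔ HasProjectiveDimensionLT (ModuleCat.of R M) 2 := by
  have key : ∀ (n : ℕ) (q : (Fin n → R) →ₗ[R] M), Function.Surjective q →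
      (Module.Projective R (LinearMap.ker q) ↔
        HasProjectiveDimensionLT (ModuleCat.of R M) 2) := by
    intro n q hq
    have hres : IsShortExactSeq (LinearMap.ker q).subtype q :=
      ⟨Subtype.val_injective, hq, LinearMap.exact_subtype_ker_map q⟩
    have hF : Projective (ModuleCat.of R (Fin n → R)) :=
      (IsProjective.iff_projective _).1 inferInstance
    rw [IsProjective.iff_projective, projective_iff_hasProjectiveDimensionLT_one]
    exact (hres.shortExact.hasProjectiveDimensionLT_X₃_iff 0 hF).symm
  constructor
  · rintro ⟨n, q, hq, h⟩
    exact (key n q hq).1 h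
  · intro h
    obtain ⟨n, q, hq⟩ := Module.Finite.exists_fin' R M
    exact ⟨n, q, hq, (key n q hq).2 h⟩

end ExtVanishing

section Membership

variable {R : Type} [Ring R] {S : Submonoid R}

theorem pdStarLE1_of_projective (M : Type) [AddCommGroup M] [Module R M] [Module.Projective R M] :
    PdStarLE1 R M := by
  have hM : Projective (ModuleCat.of R M) := (IsProjective.iff_projective M).1 inferInstance
  rw [pdStarLE1_iff]
  intro i hi x
  obtain ⟨i, rfl⟩ := Nat.exists_eq_add_of_le' (le_trans one_le_two hi)
  exact Abelian.Ext.eq_zero_of_projective x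

theorem memM_punit : MemM R S PUnit :=
  ⟨inferInstance, fun _ => ⟨1, S.one_mem, rfl⟩⟩

theorem memC_punit : MemC R S PUnit :=
  ⟨memM_punit, pdStarLE1_of_projective _⟩

theorem memP_punit [IsNoetherianRing R] : MemP R S PUnit := by
  refine ⟨memM_punit, (pdLE_one_iff _).2 ?_⟩
  have hM : Projective (ModuleCat.of R PUnit) := (IsProjective.iff_projective _).1 inferInstance
  rw [projective_iff_hasProjectiveDimensionLT_one] at hM
  exact hasProjectiveDimensionLT_of_ge _ 1 2 one_le_two

variable {A B C : Type} [AddCommGroup A] [Module R A] [AddCommGroup B] [Module R B]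
  [AddCommGroup C] [Module R C] {f : A →ₗ[R] B} {g : B →ₗ[R] C}

theorem IsShortExactSeq.memM_left [IsNoetherianRing R] (h : IsShortExactSeq f g)
    (hB : MemM R S B) : MemM R S A := by
  obtain ⟨_, hB⟩ := hB
  refine ⟨Module.Finite.of_injective f h.inj, fun a => ?_⟩
  obtain ⟨s, hs, h0⟩ := hB (f a)
  exact ⟨s, hs, h.inj (by rw [map_smul, h0, map_zero])⟩

theorem IsShortExactSeq.memM_middle [IsNoetherianRing R] (h : IsShortExactSeq f g)
    (hA : MemM R S A) (hC : MemM R S C) : MemM R S B := by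
  obtain ⟨_, hA⟩ := hA
  obtain ⟨_, hC⟩ := hC
  have : IsNoetherian R B := isNoetherian_of_range_eq_ker f g h.exact.linearMap_ker_eq.symm
  refine ⟨inferInstance, fun x => ?_⟩
  obtain ⟨s, hs, h0⟩ := hC (g x)
  obtain ⟨a, ha⟩ := (h.exact (s • x)).1 (by rw [map_smul, h0])
  obtain ⟨t, ht, h1⟩ := hA a
  exact ⟨t * s, S.mul_mem ht hs, by rw [mul_smul, ← ha, ← map_smul, h1, map_zero]⟩

theorem IsShortExactSeq.memC_left [IsNoetherianRing R] (h : IsShortExactSeq f g)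
    (hB : MemC R S B) (hC : MemC R S C) : MemC R S A :=
  ⟨h.memM_left hB.1, h.pdStarLE1_left hB.2 hC.2⟩

theorem IsShortExactSeq.memC_middle [IsNoetherianRing R] (h : IsShortExactSeq f g)
    (hA : MemC R S A) (hC : MemC R S C) : MemC R S B :=
  ⟨h.memM_middle hA.1 hC.1, h.pdStarLE1_middle hA.2 hC.2⟩

theorem IsShortExactSeq.memP_middle [IsNoetherianRing R] (h : IsShortExactSeq f g)
    (hA : MemP R S A) (hC : MemP R S C) : MemP R S B := by
  have hB := h.memM_middle hA.1 hC.1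
  have := hA.1.1
  have := hB.1
  have := hC.1.1
  exact ⟨hB, (pdLE_one_iff _).2 (h.shortExact.hasProjectiveDimensionLT_X₂ 2
    ((pdLE_one_iff _).1 hA.2) ((pdLE_one_iff _).1 hC.2))⟩

/-- An isomorphism, seen as a short exact sequence with zero kernel. -/
theorem LinearEquiv.isShortExactSeq_punit_left (e : A ≃ₗ[R] B) :
    IsShortExactSeq (0 : PUnit →ₗ[R] A) e.toLinearMap where
  inj := Function.injective_of_subsingleton _
  surj := e.surjective
  exact x := by simp [eq_comm (a := (0 : A))]

/-- An isomorphism, seen as a short exact sequence with zero cokernel. -/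
theorem LinearEquiv.isShortExactSeq_punit_right (e : A ≃ₗ[R] B) :
    IsShortExactSeq e.toLinearMap (0 : B →ₗ[R] PUnit) where
  inj := e.injective
  surj := Function.surjective_to_subsingleton _
  exact x := by simp

theorem MemC.of_equiv [IsNoetherianRing R] (e : A ≃ₗ[R] B) (hB : MemC R S B) : MemC R S A :=
  e.isShortExactSeq_punit_right.memC_left hB memC_punit

end Membership

section Pushout

variable {R : Type} [Ring R] {A B C D Q : Type} [AddCommGroup A] [Module R A]
  [AddCommGroup B] [Module R B] [AddCommGroup C] [Module R C] [AddCommGroup D] [Module R D]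
  [AddCommGroup Q] [Module R Q]

/-- `Q` is the pushout of `B ← A → C`, expressed by exactness of `A → B × C → Q → 0`. -/
structure IsModulePushout (f : A →ₗ[R] B) (g : A →ₗ[R] C) (i : B →ₗ[R] Q) (j : C →ₗ[R] Q) :
    Prop where
  surj : ∀ x, ∃ b c, i b + j c = x
  exact : ∀ b c, i b + j c = 0 ↔ ∃ a, f a = b ∧ g a = -c

theorem exists_isModulePushout (f : A →ₗ[R] B) (g : A →ₗ[R] C) :
    ∃ (Q : Type) (_ : AddCommGroup Q) (_ : Module R Q) (i : B →ₗ[R] Q) (j : C →ₗ[R] Q),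
      IsModulePushout f g i j := by
  let N := LinearMap.range (f.prod (-g))
  refine ⟨(B × C) ⧸ N, inferInstance, inferInstance, N.mkQ.comp (LinearMap.inl R B C),
    N.mkQ.comp (LinearMap.inr R B C), fun x => ?_, fun b c => ?_⟩
  · obtain ⟨⟨b, c⟩, rfl⟩ := N.mkQ_surjective x
    exact ⟨b, c, by rw [LinearMap.comp_apply, LinearMap.comp_apply, ← map_add]; simp⟩
  · simp only [LinearMap.comp_apply, ← map_add]
    rw [Submodule.mkQ_apply, Submodule.Quotient.mk_eq_zero]
    simp [N, neg_eq_iff_eq_neg]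

variable {f : A →ₗ[R] B} {g : A →ₗ[R] C} {i : B →ₗ[R] Q} {j : C →ₗ[R] Q}

namespace IsModulePushout

theorem symm (h : IsModulePushout f g i j) : IsModulePushout g f j i where
  surj x := by
    obtain ⟨b, c, hx⟩ := h.surj x
    exact ⟨c, b, by rw [add_comm, hx]⟩
  exact c b := by
    rw [add_comm, h.exact]
    constructor
    · rintro ⟨a, rfl, ha⟩
      exact ⟨-a, by simp [ha]⟩
    · rintro ⟨a, rfl, ha⟩
      exact ⟨-a, by simp [ha]⟩

theorem comm (h : IsModulePushout f g i j) (a : A) : i (f a) = j (g a) := by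
  have := (h.exact (f a) (-g a)).2 ⟨a, rfl, by simp⟩
  rwa [map_neg, ← sub_eq_add_neg, sub_eq_zero] at this

theorem exists_desc (h : IsModulePushout f g i j) {X : Type} [AddCommGroup X] [Module R X]
    (b : B →ₗ[R] X) (c : C →ₗ[R] X) (hbc : ∀ a, b (f a) = c (g a)) :
    ∃ d : Q →ₗ[R] X, (∀ x, d (i x) = b x) ∧ ∀ x, d (j x) = c x := by
  have hs : Function.Surjective (i.coprod j) := fun x => by
    obtain ⟨b, c, hx⟩ := h.surj x
    exact ⟨(b, c), hx⟩
  have hk : LinearMap.ker (i.coprod j) ≤ LinearMap.ker (b.coprod c) := by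
    rintro ⟨x, y⟩ hxy
    obtain ⟨a, rfl, ha⟩ := (h.exact x y).1 hxy
    simp [hbc, ha]
  let e := (i.coprod j).quotKerEquivOfSurjective hs
  have he : ∀ z, e.symm (i.coprod j z) = Submodule.Quotient.mk z := fun z =>
    e.symm_apply_eq.2 rfl
  refine ⟨((LinearMap.ker (i.coprod j)).liftQ (b.coprod c) hk).comp e.symm.toLinearMap,
    fun x => ?_, fun x => ?_⟩
  · simpa using congrArg ((LinearMap.ker (i.coprod j)).liftQ (b.coprod c) hk) (he (x, 0))
  · simpa using congrArg ((LinearMap.ker (i.coprod j)).liftQ (b.coprod c) hk) (he (0, x))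

theorem exists_isShortExactSeq (h : IsModulePushout f g i j) {q : B →ₗ[R] D}
    (hf : IsShortExactSeq f q) :
    ∃ r : Q →ₗ[R] D, IsShortExactSeq j r ∧ ∀ b, r (i b) = q b := by
  obtain ⟨r, hi, hj⟩ := h.exists_desc q (0 : C →ₗ[R] D)
    (fun a => by simp [hf.exact.apply_apply_eq_zero])
  refine ⟨r, ⟨?_, fun d => ?_, fun x => ⟨fun hx => ?_, ?_⟩⟩, hi⟩
  · rw [injective_iff_map_eq_zero]
    intro c hc
    obtain ⟨a, ha, ha'⟩ := (h.exact 0 c).1 (by simp [hc])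
    rw [hf.inj (ha.trans (map_zero f).symm), map_zero] at ha'
    exact neg_eq_zero.1 ha'.symm
  · obtain ⟨b, rfl⟩ := hf.surj d
    exact ⟨i b, hi b⟩
  · obtain ⟨b, c, rfl⟩ := h.surj x
    rw [map_add, hi, hj, LinearMap.zero_apply, add_zero] at hx
    obtain ⟨a, rfl⟩ := (hf.exact b).1 hx
    exact ⟨g a + c, by rw [map_add, h.comm]⟩
  · rintro ⟨c, rfl⟩
    exact hj c

end IsModulePushout

end Pushout

section Splicing

variable {R : Type} [Ring R]

theorem isShortExactSeq_ker {A B : Type} [AddCommGroup A] [Module R A] [AddCommGroup B]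
    [Module R B] {f : A →ₗ[R] B} (hf : Function.Surjective f) :
    IsShortExactSeq (LinearMap.ker f).subtype f :=
  ⟨Subtype.val_injective, hf, LinearMap.exact_subtype_ker_map f⟩

/-- The pullback of two short exact sequences with the same quotient. -/
theorem exists_pullback_isShortExactSeq {M P K P' K' : Type}
    [AddCommGroup M] [Module R M] [AddCommGroup P] [Module R P] [AddCommGroup K] [Module R K]
    [AddCommGroup P'] [Module R P'] [AddCommGroup K'] [Module R K']
    {ι : K →ₗ[R] P} {p : P →ₗ[R] M} (h : IsShortExactSeq ι p)
    {ι' : K' →ₗ[R] P'} {p' : P' →ₗ[R] M} (h' : IsShortExactSeq ι' p') :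
    ∃ (Q : Type) (_ : AddCommGroup Q) (_ : Module R Q)
      (a : K →ₗ[R] Q) (b : Q →ₗ[R] P') (a' : K' →ₗ[R] Q) (b' : Q →ₗ[R] P),
      IsShortExactSeq a b ∧ IsShortExactSeq a' b' := by
  let Q := LinearMap.eqLocus (p.comp (LinearMap.fst R P P')) (p'.comp (LinearMap.snd R P P'))
  have hmem : ∀ x : P × P', x ∈ Q ↔ p x.1 = p' x.2 := fun x => Iff.rfl
  refine ⟨Q, inferInstance, inferInstance,
    LinearMap.codRestrict Q ((LinearMap.inl R P P').comp ι)
      (fun k => by simp [hmem, h.exact.apply_apply_eq_zero]),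
    (LinearMap.snd R P P').comp Q.subtype,
    LinearMap.codRestrict Q ((LinearMap.inr R P P').comp ι')
      (fun k => by simp [hmem, h'.exact.apply_apply_eq_zero]),
    (LinearMap.fst R P P').comp Q.subtype, ⟨?_, ?_, ?_⟩, ⟨?_, ?_, ?_⟩⟩
  · intro x y hxy
    exact h.inj (congrArg (fun z : Q => z.1.1) hxy)
  · intro y
    obtain ⟨x, hx⟩ := h.surj (p' y)
    exact ⟨⟨(x, y), hx⟩, rfl⟩
  · rintro ⟨⟨x, y⟩, hxy⟩
    constructor
    · rintro (rfl : y = 0)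
      obtain ⟨k, rfl⟩ := (h.exact x).1 (by simpa [hmem] using hxy)
      exact ⟨k, rfl⟩
    · rintro ⟨k, hk⟩
      exact (congrArg (fun z : Q => z.1.2) hk).symm
  · intro x y hxy
    exact h'.inj (congrArg (fun z : Q => z.1.2) hxy)
  · intro x
    obtain ⟨y, hy⟩ := h'.surj (p x)
    exact ⟨⟨(x, y), hy.symm⟩, rfl⟩
  · rintro ⟨⟨x, y⟩, hxy⟩
    constructor
    · rintro (rfl : x = 0)
      obtain ⟨k, rfl⟩ := (h'.exact y).1 (by simpa [hmem, eq_comm] using hxy)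
      exact ⟨k, rfl⟩
    · rintro ⟨k, hk⟩
      exact (congrArg (fun z : Q => z.1.1) hk).symm

/-- An extension of a module of projective dimension at most one by `K` lifts along an epimorphism
onto `K`. -/
theorem exists_extension_lift {K₂ P₁ K Q P' : Type}
    [AddCommGroup K₂] [Module R K₂] [AddCommGroup P₁] [Module R P₁] [AddCommGroup K] [Module R K]
    [AddCommGroup Q] [Module R Q] [AddCommGroup P'] [Module R P']
    {ι : K₂ →ₗ[R] P₁} {p : P₁ →ₗ[R] K} (h : IsShortExactSeq ι p)
    {κ : K →ₗ[R] Q} {q : Q →ₗ[R] P'} (hQ : IsShortExactSeq κ q) (hP' : PdLE R 1 P') :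
    ∃ (E : Type) (_ : AddCommGroup E) (_ : Module R E)
      (a : K₂ →ₗ[R] E) (b : E →ₗ[R] Q) (c : P₁ →ₗ[R] E) (d : E →ₗ[R] P'),
      IsShortExactSeq a b ∧ IsShortExactSeq c d := by
  obtain ⟨n, φ, hφ, hL⟩ := hP'
  have hL : Module.Projective R (LinearMap.ker φ) := hL
  have hres := isShortExactSeq_ker hφ
  obtain ⟨β, hβ⟩ := Module.projective_lifting_property q φ hQ.surj
  have hβ : ∀ x, q (β x) = φ x := LinearMap.congr_fun hβ
  have hβκ : ∀ l : LinearMap.ker φ, β l ∈ LinearMap.range κ := fun l =>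
    (hQ.exact _).1 (by rw [hβ]; exact l.2)
  let κe := LinearEquiv.ofInjective κ hQ.inj
  obtain ⟨t, ht⟩ := Module.projective_lifting_property p
    (κe.symm.toLinearMap.comp (LinearMap.codRestrict _ (β.comp (LinearMap.ker φ).subtype) hβκ))
    h.surj
  have ht : ∀ l : LinearMap.ker φ, κ (p (t l)) = β l := fun l => by
    have h1 := congrArg (fun z => (κe z : Q)) (LinearMap.congr_fun ht l)
    have h2 : κ (p (t l)) = (LinearMap.codRestrict (LinearMap.range κ)
        (β.comp (LinearMap.ker φ).subtype) hβκ l : Q) := by simpa [κe] using h1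
    exact h2
  obtain ⟨E, _, _, i, j, hE⟩ := exists_isModulePushout (LinearMap.ker φ).subtype t
  obtain ⟨r, hr, hri⟩ := hE.exists_isShortExactSeq hres
  obtain ⟨b, hbi, hbj⟩ := hE.exists_desc β (κ.comp p) (fun l => (ht l).symm)
  refine ⟨E, _, _, j.comp ι, b, j, r, ⟨hr.inj.comp h.inj, fun x => ?_, fun e => ⟨fun he => ?_, ?_⟩⟩,
    hr⟩
  · obtain ⟨y, hy⟩ := hφ (q x)
    obtain ⟨k, hk⟩ := (hQ.exact (x - β y)).1 (by rw [map_sub, hβ, hy, sub_self])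
    obtain ⟨c, rfl⟩ := h.surj k
    exact ⟨i y + j c, by rw [map_add, hbi, hbj, LinearMap.comp_apply, hk, add_sub_cancel]⟩
  · obtain ⟨y, c, rfl⟩ := hE.surj e
    rw [map_add, hbi, hbj, LinearMap.comp_apply] at he
    have hy : φ y = 0 := by
      have := congrArg q he
      rwa [map_add, hβ, hQ.exact.apply_apply_eq_zero, add_zero, map_zero] at this
    have hc : i y = j (t ⟨y, hy⟩) := hE.comm ⟨y, hy⟩
    rw [← ht ⟨y, hy⟩, ← map_add, ← map_add] at he
    obtain ⟨k, hk⟩ := (h.exact _).1 (hQ.inj (he.trans (map_zero κ).symm))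
    exact ⟨k, by rw [LinearMap.comp_apply, hk, map_add, hc]⟩
  · rintro ⟨k, rfl⟩
    rw [LinearMap.comp_apply, hbj, LinearMap.comp_apply, h.exact.apply_apply_eq_zero, map_zero]

/-- An extension of `K` by a module of projective dimension at most one extends along a
monomorphism out of `K` whose cokernel satisfies `pd* ≤ 1`. -/
theorem exists_extension_extend [IsNoetherianRing R] {K P₁ K₂ P' Q : Type}
    [AddCommGroup K₂] [Module R K₂] [AddCommGroup P₁] [Module R P₁] [AddCommGroup K] [Module R K]
    [AddCommGroup Q] [Module R Q] [AddCommGroup P'] [Module R P']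
    {ι : K →ₗ[R] P₁} {p : P₁ →ₗ[R] K₂} (h : IsShortExactSeq ι p)
    {κ : P' →ₗ[R] Q} {q : Q →ₗ[R] K} (hQ : IsShortExactSeq κ q) (hP' : PdLE R 1 P')
    (hK₂ : PdStarLE1 R K₂) :
    ∃ (E : Type) (_ : AddCommGroup E) (_ : Module R E)
      (a : Q →ₗ[R] E) (b : E →ₗ[R] K₂) (c : P' →ₗ[R] E) (d : E →ₗ[R] P₁),
      IsShortExactSeq a b ∧ IsShortExactSeq c d := by
  let φ : (P₁ →₀ R) →ₗ[R] P₁ := Finsupp.linearCombination R id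
  have hφ : Function.Surjective φ := Finsupp.linearCombination_id_surjective R P₁
  let Y : Submodule R (P₁ →₀ R) := LinearMap.ker (p.comp φ)
  have hpφ : Function.Surjective (p.comp φ) := h.surj.comp hφ
  have hY := isShortExactSeq_ker hpφ
  have hres := isShortExactSeq_ker hφ
  let ιe := LinearEquiv.ofInjective ι h.inj
  have hφι : ∀ y : Y, φ y ∈ LinearMap.range ι := fun y => (h.exact _).1 y.2
  let τ : Y →ₗ[R] K := ιe.symm.toLinearMap.comp
    (LinearMap.codRestrict _ (φ.comp Y.subtype) hφι)
  have hτ : ∀ y : Y, ι (τ y) = φ y := fun y => by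
    have : ((ιe (τ y) : LinearMap.range ι) : P₁) = φ y := by
      simp only [τ, LinearMap.comp_apply, LinearEquiv.coe_coe, LinearEquiv.apply_symm_apply]
      rfl
    simpa [ιe] using this
  obtain ⟨s, hs⟩ : ∃ s : Y →ₗ[R] Q, q.comp s = τ := exists_lift_of_pdStarLE1 hY hK₂ hP' hQ τ
  have hs : ∀ y, q (s y) = τ y := LinearMap.congr_fun hs
  have hZY : LinearMap.ker φ ≤ Y := fun z hz => by
    change p (φ z) = 0
    rw [LinearMap.mem_ker.1 hz, map_zero]
  have hsκ : ∀ z : LinearMap.ker φ, s (Submodule.inclusion hZY z) ∈ LinearMap.range κ := fun z =>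
    (hQ.exact _).1 (h.inj (by rw [hs, hτ, map_zero]; exact z.2))
  let κe := LinearEquiv.ofInjective κ hQ.inj
  let t : LinearMap.ker φ →ₗ[R] P' := κe.symm.toLinearMap.comp
    (LinearMap.codRestrict _ (s.comp (Submodule.inclusion hZY)) hsκ)
  have ht : ∀ z, κ (t z) = s (Submodule.inclusion hZY z) := fun z => by
    have : ((κe (t z) : LinearMap.range κ) : Q) = s (Submodule.inclusion hZY z) := by simp [t]
    simpa [κe] using this
  have hpQ : IsModulePushout (A := LinearMap.ker φ) (B := Y) (Submodule.inclusion hZY) t s κ := by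
    refine ⟨fun x => ?_, fun y c => ⟨fun hyc => ?_, ?_⟩⟩
    · obtain ⟨y, hy⟩ := hφ (ι (q x))
      have hyY : y ∈ Y := by
        change p (φ y) = 0
        rw [hy, h.exact.apply_apply_eq_zero]
      have h1 : q (s ⟨y, hyY⟩) = q x := h.inj (by rw [hs, hτ, ← hy])
      obtain ⟨c, hc⟩ := (hQ.exact (x - s ⟨y, hyY⟩)).1 (by rw [map_sub, h1, sub_self])
      exact ⟨⟨y, hyY⟩, c, by rw [hc, add_sub_cancel]⟩
    · have hy : φ y = 0 := by
        have := congrArg q hyc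
        rw [map_add, hs, hQ.exact.apply_apply_eq_zero, add_zero, map_zero] at this
        rw [← hτ, this, map_zero]
      refine ⟨⟨y, hy⟩, rfl, hQ.inj ?_⟩
      rw [ht, map_neg]
      exact eq_neg_of_add_eq_zero_left hyc
    · rintro ⟨z, rfl, hz⟩
      rw [← ht, hz, map_neg, neg_add_cancel]
  obtain ⟨E, _, _, i, j, hE⟩ := exists_isModulePushout (A := LinearMap.ker φ) (B := P₁ →₀ R) (LinearMap.ker φ).subtype t
  obtain ⟨r, hr, hri⟩ := hE.exists_isShortExactSeq hres
  obtain ⟨a, has, haκ⟩ := hpQ.exists_desc (i.comp Y.subtype) j (fun z => hE.comm z)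
  refine ⟨E, _, _, a, p.comp r, j, r, ⟨?_, h.surj.comp hr.surj, fun e => ⟨fun he => ?_, ?_⟩⟩, hr⟩
  · rw [injective_iff_map_eq_zero]
    intro x hx
    obtain ⟨y, c, rfl⟩ := hpQ.surj x
    rw [map_add, has, haκ] at hx
    obtain ⟨z, hz, hz'⟩ := (hE.exact y c).1 hx
    exact (hpQ.exact y c).2 ⟨z, Subtype.ext hz, hz'⟩
  · obtain ⟨y, c, rfl⟩ := hE.surj e
    rw [LinearMap.comp_apply, map_add, hri, hr.exact.apply_apply_eq_zero, add_zero] at he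
    exact ⟨s ⟨y, he⟩ + κ c, by rw [map_add, has, haκ]; rfl⟩
  · rintro ⟨x, rfl⟩
    obtain ⟨y, c, rfl⟩ := hpQ.surj x
    rw [LinearMap.comp_apply, map_add, has, haκ, map_add, hr.exact.apply_apply_eq_zero, add_zero,
      LinearMap.comp_apply, hri]
    exact y.2

end Splicing

section ShiftChain

/-- A short exact sequence with middle term `Y` and outer terms `X` and `Z`: it reads
`0 → X → Y → Z → 0` if `neg` is true, and `0 → Z → Y → X → 0` otherwise. -/
def IsStep (R : Type) [Ring R] (neg : Bool) (X Y Z : Type) [AddCommGroup X] [Module R X]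
    [AddCommGroup Y] [Module R Y] [AddCommGroup Z] [Module R Z] : Prop :=
  match neg with
  | true => ∃ (f : X →ₗ[R] Y) (g : Y →ₗ[R] Z), IsShortExactSeq f g
  | false => ∃ (f : Z →ₗ[R] Y) (g : Y →ₗ[R] X), IsShortExactSeq f g

/-- `ω` is computed by splicing `n` short exact sequences with middle terms in `𝓟`, starting from
`M`, to the right if `neg` is true and to the left otherwise. -/
def ShiftChain (R : Type) [Ring R] (S : Submonoid R) {Ω : Type} [CommMonoid Ω]
    (F : (M : Type) → [AddCommGroup M] → [Module R M] → Ω) (neg : Bool) :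
    ℕ → (M : Type) → [AddCommGroup M] → [Module R M] → Ω → Prop
  | 0, M, _, _ => fun ω => ω = F M
  | n + 1, M, _, _ => fun ω =>
    ∃ (P K : Type) (_ : AddCommGroup P) (_ : Module R P) (_ : AddCommGroup K) (_ : Module R K),
      IsStep R neg M P K ∧ MemC R S P ∧ MemP R S P ∧ MemC R S K ∧
      ∃ U : Ωˣ, U = F P ∧ ∃ ω₀, ShiftChain R S F neg n K ω₀ ∧
        ω = (U ^ ((-1 : ℤ) ^ (n + 1)) : Ωˣ) * ω₀

variable {R : Type} [Ring R] {S : Submonoid R} {neg : Bool}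

section Step

variable {X Y Z : Type} [AddCommGroup X] [Module R X] [AddCommGroup Y] [Module R Y]
  [AddCommGroup Z] [Module R Z]

theorem IsStep.memC [IsNoetherianRing R] (h : IsStep R neg X Y Z) (hX : MemC R S X) (hZ : MemC R S Z) :
    MemC R S Y := by
  cases neg
  · obtain ⟨f, g, h⟩ := h
    exact h.memC_middle hZ hX
  · obtain ⟨f, g, h⟩ := h
    exact h.memC_middle hX hZ

theorem IsStep.memP [IsNoetherianRing R] (h : IsStep R neg X Y Z) (hX : MemP R S X) (hZ : MemP R S Z) :
    MemP R S Y := by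
  cases neg
  · obtain ⟨f, g, h⟩ := h
    exact h.memP_middle hZ hX
  · obtain ⟨f, g, h⟩ := h
    exact h.memP_middle hX hZ

variable {Ω : Type} [CommMonoid Ω] {F : (M : Type) → [AddCommGroup M] → [Module R M] → Ω}

theorem IsQuasiFittingInv.map_step (hF : IsQuasiFittingInv R S F) (h : IsStep R neg X Y Z)
    (hX : MemP R S X) (hY : MemC R S Y) (hZ : MemC R S Z) : F Y = F X * F Z := by
  cases neg
  · obtain ⟨f, g, h⟩ := h
    exact hF.2.1 _ _ _ hZ hY hX f g h.inj h.surj h.exact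
  · obtain ⟨f, g, h⟩ := h
    exact hF.2.2 _ _ _ hX hY hZ f g h.inj h.surj h.exact

theorem IsQuasiFittingInv.map_punit [IsNoetherianRing R] (hF : IsQuasiFittingInv R S F) : F PUnit = 1 := by
  have h := hF.2.1 PUnit PUnit PUnit memC_punit memC_punit memP_punit 0 0
    (Function.injective_of_subsingleton _) (Function.surjective_to_subsingleton _)
    (fun x => by simp)
  exact ((hF.1 PUnit memP_punit).mul_eq_left.1 h.symm)

theorem IsQuasiFittingInv.map_equiv [IsNoetherianRing R] (hF : IsQuasiFittingInv R S F) (e : X ≃ₗ[R] Y)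
    (hY : MemC R S Y) : F X = F Y := by
  have h := e.isShortExactSeq_punit_left
  rw [hF.2.2 _ _ _ memP_punit (hY.of_equiv e) hY _ _ h.inj h.surj h.exact, hF.map_punit, one_mul]

end Step

theorem IsStep.exists_square {M P K P' K' : Type}
    [AddCommGroup M] [Module R M] [AddCommGroup P] [Module R P] [AddCommGroup K] [Module R K]
    [AddCommGroup P'] [Module R P'] [AddCommGroup K'] [Module R K']
    (h : IsStep R neg M P K) (h' : IsStep R neg M P' K') :
    ∃ (Q : Type) (_ : AddCommGroup Q) (_ : Module R Q),
      IsStep R neg P' Q K ∧ IsStep R neg P Q K' := by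
  cases neg
  · obtain ⟨f, g, h⟩ := h
    obtain ⟨f', g', h'⟩ := h'
    obtain ⟨Q, _, _, a, b, a', b', hQ, hQ'⟩ := exists_pullback_isShortExactSeq h h'
    exact ⟨Q, _, _, ⟨a, b, hQ⟩, ⟨a', b', hQ'⟩⟩
  · obtain ⟨f, g, h⟩ := h
    obtain ⟨f', g', h'⟩ := h'
    obtain ⟨Q, _, _, i, j, hQ⟩ := exists_isModulePushout f f'
    obtain ⟨r, hr, -⟩ := hQ.exists_isShortExactSeq h
    obtain ⟨r', hr', -⟩ := hQ.symm.exists_isShortExactSeq h'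
    exact ⟨Q, _, _, ⟨j, r, hr⟩, ⟨i, r', hr'⟩⟩

theorem IsStep.exists_extension [IsNoetherianRing R] {K P₁ K₂ P' Q : Type}
    [AddCommGroup K₂] [Module R K₂] [AddCommGroup P₁] [Module R P₁] [AddCommGroup K] [Module R K]
    [AddCommGroup Q] [Module R Q] [AddCommGroup P'] [Module R P']
    (h : IsStep R neg K P₁ K₂) (hQ : IsStep R neg P' Q K) (hP' : MemP R S P')
    (hK₂ : MemC R S K₂) :
    ∃ (E : Type) (_ : AddCommGroup E) (_ : Module R E),
      IsStep R neg Q E K₂ ∧ IsStep R neg P' E P₁ := by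
  cases neg
  · obtain ⟨f, g, h⟩ := h
    obtain ⟨f', g', hQ⟩ := hQ
    obtain ⟨E, _, _, a, b, c, d, hE, hE'⟩ := exists_extension_lift h hQ hP'.2
    exact ⟨E, _, _, ⟨a, b, hE⟩, ⟨c, d, hE'⟩⟩
  · obtain ⟨f, g, h⟩ := h
    obtain ⟨f', g', hQ⟩ := hQ
    obtain ⟨E, _, _, a, b, c, d, hE, hE'⟩ := exists_extension_extend h hQ hP'.2 hK₂.2
    exact ⟨E, _, _, ⟨a, b, hE⟩, ⟨c, d, hE'⟩⟩

variable {Ω : Type} [CommMonoid Ω] {F : (M : Type) → [AddCommGroup M] → [Module R M] → Ω}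

variable [IsNoetherianRing R]

theorem ShiftChain.of_isStep (hF : IsQuasiFittingInv R S F) {n : ℕ} {K Q P' : Type}
    [AddCommGroup K] [Module R K] [AddCommGroup Q] [Module R Q] [AddCommGroup P'] [Module R P']
    (hQ : IsStep R neg P' Q K) (hP'C : MemC R S P') (hP' : MemP R S P') (hK : MemC R S K)
    {U' : Ωˣ} (hU' : (U' : Ω) = F P') {ω : Ω} (hω : ShiftChain R S F neg n K ω) :
    ShiftChain R S F neg n Q ((U' ^ ((-1 : ℤ) ^ n) : Ωˣ) * ω) := by
  cases n with
  | zero =>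
    change _ = _ at hω
    change _ = F Q
    rw [hF.map_step hQ hP' (hQ.memC hP'C hK) hK, hω, hU'.symm]
    simp
  | succ n =>
    obtain ⟨P₁, K₂, _, _, _, _, h, hP₁C, hP₁, hK₂, U, hU, ω₀, hω₀, rfl⟩ := hω
    obtain ⟨E, _, _, hE, hE'⟩ := h.exists_extension hQ hP' hK₂
    refine ⟨E, K₂, _, _, _, _, hE, hE'.memC hP'C hP₁C, hE'.memP hP' hP₁, hK₂, U' * U, ?_, ω₀,
      hω₀, ?_⟩
    · rw [hF.map_step hE' hP' (hE'.memC hP'C hP₁C) hP₁C, Units.val_mul, hU, hU']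
    · rw [mul_zpow, Units.val_mul, mul_assoc]

theorem ShiftChain.unique (hF : IsQuasiFittingInv R S F) {n : ℕ} {M : Type}
    [AddCommGroup M] [Module R M] {ω ω' : Ω} (h : ShiftChain R S F neg n M ω)
    (h' : ShiftChain R S F neg n M ω') : ω = ω' := by
  induction n generalizing M ω ω' with
  | zero =>
    change _ = _ at h h'
    rw [h, h']
  | succ n ih =>
    obtain ⟨P, K, _, _, _, _, h, hPC, hP, hK, U, hU, ω₀, hω₀, rfl⟩ := h
    obtain ⟨P', K', _, _, _, _, h', hPC', hP', hK', U', hU', ω₀', hω₀', rfl⟩ := h'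
    obtain ⟨Q, _, _, hQ, hQ'⟩ := h.exists_square h'
    have key := ih (hω₀.of_isStep hF hQ hPC' hP' hK hU') (hω₀'.of_isStep hF hQ' hPC hP hK' hU)
    have hinv : ∀ V : Ωˣ, V ^ ((-1 : ℤ) ^ (n + 1)) = (V ^ ((-1 : ℤ) ^ n))⁻¹ := fun V => by
      rw [pow_succ, mul_neg_one, zpow_neg]
    rw [hinv, hinv, Units.inv_mul_eq_iff_eq_mul, mul_left_comm, Units.eq_inv_mul_iff_mul_eq, key]

theorem ShiftChain.of_equiv (hF : IsQuasiFittingInv R S F) {n : ℕ} {M N : Type}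
    [AddCommGroup M] [Module R M] [AddCommGroup N] [Module R N] (e : M ≃ₗ[R] N)
    (hN : MemC R S N) {ω : Ω} (h : ShiftChain R S F neg n N ω) : ShiftChain R S F neg n M ω := by
  cases n with
  | zero => exact Eq.trans h (hF.map_equiv e hN).symm
  | succ n =>
    obtain ⟨P, K, _, _, _, _, h, h1⟩ := h
    refine ⟨P, K, _, _, _, _, ?_, h1⟩
    cases neg
    · obtain ⟨f, g, h⟩ := h
      exact ⟨f, e.symm.toLinearMap.comp g, h.inj, e.symm.surjective.comp h.surj,
        fun x => by simpa using h.exact x⟩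
    · obtain ⟨f, g, h⟩ := h
      exact ⟨f.comp e.toLinearMap, g, h.inj.comp e.injective, h.surj,
        fun x => (h.exact x).trans (by simp)⟩

end ShiftChain

section ExactSequences

theorem Units.zpow_neg_one_pow_eq_ite {Ω : Type} [CommMonoid Ω] (U : Ωˣ) {a u : Ω} (ha : U = a)
    (hu : a * u = 1) (k : ℕ) :
    ((U ^ ((-1 : ℤ) ^ k) : Ωˣ) : Ω) = if k % 2 = 1 then u else a := by
  split_ifs with hk
  · rw [Odd.neg_one_pow (Nat.odd_iff.2 hk), zpow_neg_one, Units.inv_eq_of_mul_eq_one_right]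
    rw [ha, hu]
  · rw [Even.neg_one_pow (Nat.even_iff.2 (by lia)), zpow_one, ha]

variable {R : Type} [Ring R] {D : ModSeq R} {n : ℕ}

theorem ModSeq.ExactTrunc.isShortExactSeq_range (h : D.ExactTrunc n) {i : ℕ} (hi : i < n) :
    IsShortExactSeq (LinearMap.range (D.f i)).subtype (D.f (i + 1)).rangeRestrict where
  inj := Subtype.val_injective
  surj := LinearMap.surjective_rangeRestrict _
  exact x := by
    rw [← LinearMap.mem_ker, LinearMap.ker_rangeRestrict, LinearMap.mem_ker, h.2.2 i hi x]
    simp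

variable [IsNoetherianRing R] {S : Submonoid R}

theorem ModSeq.ExactTrunc.memC_range (h : D.ExactTrunc n) (hC : ∀ i ≤ n + 1, MemC R S (D.C i))
    {i : ℕ} (hi : i ≤ n) : MemC R S (LinearMap.range (D.f i)) := by
  induction hi using Nat.decreasingInduction with
  | self => exact (hC _ le_rfl).of_equiv (LinearEquiv.ofTop _ (LinearMap.range_eq_top.2 h.2.1))
  | of_succ i hi ih => exact (h.isShortExactSeq_range hi).memC_left (hC _ (by lia)) ih

variable {Ω : Type} [CommMonoid Ω] {F : (M : Type) → [AddCommGroup M] → [Module R M] → Ω}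

theorem PosShiftValue.shiftChain (hF : IsQuasiFittingInv R S F) {M : Type} [AddCommGroup M]
    [Module R M] {ω : Ω} (hω : PosShiftValue R S (MemCFam R S) F n M ω) :
    ShiftChain R S F false n M ω := by
  obtain ⟨D, hD, ⟨e⟩, hC, hP, u, hu, rfl⟩ := hω
  have hC : ∀ i ≤ n + 1, MemC R S (D.C i) := hC
  have key : ∀ k ≤ n, ShiftChain R S F false k (LinearMap.range (D.f k))
      ((∏ i ∈ Finset.range k, if (i + 1) % 2 = 1 then u (i + 1) else F (D.C (i + 1))) *
        F (D.C 0)) := by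
    intro k
    induction k with
    | zero =>
      intro _
      change _ = _
      rw [Finset.prod_range_zero, one_mul]
      exact hF.map_equiv (LinearEquiv.ofInjective _ hD.1) (hD.memC_range hC (Nat.zero_le n))
    | succ k ih =>
      intro hk
      obtain ⟨U, hU⟩ := hF.1 _ (hP (k + 1) (by lia) hk)
      refine ⟨D.C (k + 1), LinearMap.range (D.f k), _, _, _, _,
        ⟨_, _, hD.isShortExactSeq_range hk⟩, hC _ (by lia), hP _ (by lia) hk,
        hD.memC_range hC (by lia), U, hU, _, ih (by lia), ?_⟩
      rw [U.zpow_neg_one_pow_eq_ite hU (hu _ (by lia) hk), Finset.prod_range_succ, ← mul_assoc]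
      congr 1
      exact mul_comm _ _
  exact (key n le_rfl).of_equiv hF
    (e.symm.trans (LinearEquiv.ofTop _ (LinearMap.range_eq_top.2 hD.2.1)).symm)
    (hD.memC_range hC le_rfl)

theorem NegShiftValue.shiftChain (hF : IsQuasiFittingInv R S F) {M : Type} [AddCommGroup M]
    [Module R M] {ω : Ω} (hω : NegShiftValue R S (MemCFam R S) F n M ω) :
    ShiftChain R S F true n M ω := by
  obtain ⟨D, hD, ⟨e⟩, hC, hP, u, hu, rfl⟩ := hω
  have hC : ∀ i ≤ n + 1, MemC R S (D.C i) := hC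
  have key : ∀ k j, j + k = n → ShiftChain R S F true k (LinearMap.range (D.f j))
      ((∏ i ∈ Finset.range k, if (i + 1) % 2 = 1 then u (n - i) else F (D.C (n - i))) *
        F (D.C (n + 1))) := by
    intro k
    induction k with
    | zero =>
      rintro j rfl
      change _ = _
      rw [Finset.prod_range_zero, one_mul]
      exact (hF.map_equiv (LinearEquiv.ofTop _ (LinearMap.range_eq_top.2 hD.2.1))
        (hC _ le_rfl)).symm
    | succ k ih =>
      intro j hj
      obtain ⟨U, hU⟩ := hF.1 _ (hP (j + 1) (by lia) (by lia))
      refine ⟨D.C (j + 1), LinearMap.range (D.f (j + 1)), _, _, _, _,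
        ⟨_, _, hD.isShortExactSeq_range (by lia)⟩, hC _ (by lia), hP _ (by lia) (by lia),
        hD.memC_range hC (by lia), U, hU, _, ih (j + 1) (by lia), ?_⟩
      rw [U.zpow_neg_one_pow_eq_ite hU (hu _ (by lia) (by lia)), Finset.prod_range_succ,
        ← mul_assoc, show n - k = j + 1 by lia]
      congr 1
      exact mul_comm _ _
  exact (key n 0 (zero_add n)).of_equiv hF (e.symm.trans (LinearEquiv.ofInjective _ hD.1))
    (hD.memC_range hC (Nat.zero_le n))

theorem ShiftValue.shiftChain (hF : IsQuasiFittingInv R S F) {n : ℤ} {M : Type} [AddCommGroup M]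
    [Module R M] {ω : Ω} (hω : ShiftValue R S (MemCFam R S) F n M ω) :
    ShiftChain R S F (decide (n < 0)) n.natAbs M ω := by
  rw [ShiftValue] at hω
  split_ifs at hω with hn
  · rw [decide_eq_false (by lia), show n.natAbs = n.toNat by lia]
    exact hω.shiftChain hF
  · rw [decide_eq_true (by lia), show n.natAbs = (-n).toNat by lia]
    exact hω.shiftChain hF

end ExactSequences

section BaseChange

variable {R R' : Type} [Ring R] [Ring R'] {π : R →+* R'}

theorem exists_isBaseChangeAlong (π : R →+* R') (M : Type) [AddCommGroup M] [Module R M] :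
    ∃ (B : Type) (_ : AddCommGroup B) (_ : Module R' B) (ιB : M →ₛₗ[π] B),
      IsBaseChangeAlong π M B ιB := by
  let N : Submodule R' (M →₀ R') := Submodule.span R'
    (Set.range (fun x : M × M => Finsupp.single (x.1 + x.2) (1 : R') -
        (Finsupp.single x.1 1 + Finsupp.single x.2 1)) ∪
      Set.range (fun x : R × M => Finsupp.single (x.1 • x.2) (1 : R') -
        π x.1 • Finsupp.single x.2 1))
  refine ⟨(M →₀ R') ⧸ N, inferInstance, inferInstance,
    { toFun := fun m => N.mkQ (Finsupp.single m 1)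
      map_add' := fun x y => ?_
      map_smul' := fun r x => ?_ }, fun X _ _ g => ?_⟩
  · rw [← map_add, ← sub_eq_zero, ← map_sub, Submodule.mkQ_apply, Submodule.Quotient.mk_eq_zero]
    exact Submodule.subset_span (Or.inl ⟨(x, y), rfl⟩)
  · rw [← map_smul, ← sub_eq_zero, ← map_sub, Submodule.mkQ_apply, Submodule.Quotient.mk_eq_zero]
    exact Submodule.subset_span (Or.inr ⟨(r, x), rfl⟩)
  · refine ⟨N.liftQ (Finsupp.linearCombination R' g) ?_, fun m => ?_, fun h hh => ?_⟩
    · rw [Submodule.span_le]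
      rintro _ (⟨x, rfl⟩ | ⟨x, rfl⟩)
      · simp
      · simp
    · change N.liftQ _ _ (N.mkQ _) = _
      simp
    · refine Submodule.linearMap_qext _ (Finsupp.lhom_ext' fun m => LinearMap.ext_ring ?_)
      have h1 : h (N.mkQ (Finsupp.single m 1)) = g m := hh m
      simpa using h1

namespace IsBaseChangeAlong

section Basic

variable {A A' : Type} [AddCommGroup A] [Module R A] [AddCommGroup A'] [Module R' A']
  {ιA : A →ₛₗ[π] A'} {X : Type} [AddCommGroup X] [Module R' X]

theorem hom_ext (hA : IsBaseChangeAlong π A A' ιA) {h h' : A' →ₗ[R'] X}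
    (H : ∀ a, h (ιA a) = h' (ιA a)) : h = h' :=
  (hA X (h'.comp ιA)).unique H fun _ => rfl

theorem exists_map (hA : IsBaseChangeAlong π A A' ιA) {B : Type} [AddCommGroup B]
    [Module R B] (ιB : B →ₛₗ[π] X) (f : A →ₗ[R] B) :
    ∃ f' : A' →ₗ[R'] X, ∀ a, f' (ιA a) = ιB (f a) :=
  (hA X (ιB.comp f)).exists

theorem eq_top_of_mem (hA : IsBaseChangeAlong π A A' ιA) {N : Submodule R' A'}
    (hN : ∀ a, ιA a ∈ N) : N = ⊤ := by
  have h : N.mkQ = 0 := hA.hom_ext fun a => (Submodule.Quotient.mk_eq_zero N).2 (hN a)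
  rw [← N.ker_mkQ, h, LinearMap.ker_zero]

theorem exists_prod (hA : IsBaseChangeAlong π A A' ιA) {B B' : Type}
    [AddCommGroup B] [Module R B] [AddCommGroup B'] [Module R' B']
    {ιB : B →ₛₗ[π] B'} (hB : IsBaseChangeAlong π B B' ιB) :
    ∃ ι : A × B →ₛₗ[π] A' × B', IsBaseChangeAlong π (A × B) (A' × B') ι ∧
      ∀ x, ι x = (ιA x.1, ιB x.2) := by
  refine ⟨((LinearMap.inl R' A' B').comp ιA).comp (LinearMap.fst R A B) +
    ((LinearMap.inr R' A' B').comp ιB).comp (LinearMap.snd R A B), fun X _ _ g => ?_,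
    fun x => by simp⟩
  obtain ⟨a, ha⟩ := (hA X (g.comp (LinearMap.inl R A B))).exists
  obtain ⟨b, hb⟩ := (hB X (g.comp (LinearMap.inr R A B))).exists
  refine ⟨a.coprod b, fun m => ?_, fun h hh => LinearMap.prod_ext (hA.hom_ext fun x => ?_)
    (hB.hom_ext fun x => ?_)⟩
  · simp [ha, hb, ← map_add]
  · simpa [ha] using hh (x, 0)
  · simpa [hb] using hh (0, x)

theorem projective (hA : IsBaseChangeAlong π A A' ιA) [Module.Projective R A] :
    Module.Projective R' A' := by
  refine Module.Projective.of_lifting_property'' fun f hf => ?_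
  obtain ⟨s, hs⟩ := Module.projective_lifting_property (Finsupp.linearCombination R (id : A → A))
    LinearMap.id (Finsupp.linearCombination_id_surjective R A)
  choose x hx using fun a => hf (ιA a)
  let σ : (A →₀ R) →ₛₗ[π] (A' →₀ R') :=
    { toFun := fun v => v.sum fun a r => π r • x a
      map_add' := fun v w => Finsupp.sum_add_index' (by simp) (by simp [add_smul])
      map_smul' := fun r v => by
        rw [Finsupp.sum_smul_index (by simp), Finsupp.smul_sum]
        simp [mul_smul] }
  obtain ⟨h, hh⟩ := (hA _ (σ.comp s)).exists
  refine ⟨h, hA.hom_ext fun a => ?_⟩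
  have h1 : Finsupp.linearCombination R (id : A → A) (s a) = a := LinearMap.congr_fun hs a
  have h2 : ∀ v, f (σ v) = ιA (Finsupp.linearCombination R (id : A → A) v) := fun v => by
    change f (v.sum fun a r => π r • x a) = ιA (v.sum fun a r => r • a)
    simp [Finsupp.sum, hx]
  rw [LinearMap.comp_apply, hh, LinearMap.comp_apply, h2, h1, LinearMap.id_apply]

end Basic

theorem pi_fin (π : R →+* R') (k : ℕ) :
    IsBaseChangeAlong π (Fin k → R) (Fin k → R')
      { toFun := fun v i => π (v i)
        map_add' := fun v w => funext fun i => map_add π (v i) (w i)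
        map_smul' := fun r v => funext fun i => map_mul π r (v i) } := by
  intro X _ _ g
  refine ⟨(Pi.basisFun R' (Fin k)).constr ℕ fun i => g (Pi.single i 1), fun v => ?_,
    fun h hh => (Pi.basisFun R' (Fin k)).ext fun i => ?_⟩
  · rw [Module.Basis.constr_apply_fintype]
    conv_rhs => rw [← Finset.univ_sum_single v, map_sum]
    refine Finset.sum_congr rfl fun i _ => ?_
    rw [Pi.basisFun_equivFun, LinearEquiv.refl_apply]
    change π (v i) • g (Pi.single i 1) = _
    rw [← map_smulₛₗ, ← Pi.single_smul, smul_eq_mul, mul_one]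
  · rw [Module.Basis.constr_basis, ← hh, Pi.basisFun_apply]
    congr 1
    funext j
    simp [Pi.single_apply, apply_ite π]

variable {A B C A' B' C' : Type} [AddCommGroup A] [Module R A] [AddCommGroup A'] [Module R' A']
  [AddCommGroup B] [Module R B] [AddCommGroup B'] [Module R' B']
  [AddCommGroup C] [Module R C] [AddCommGroup C'] [Module R' C']
  {ιA : A →ₛₗ[π] A'} {ιB : B →ₛₗ[π] B'} {ιC : C →ₛₗ[π] C'}

theorem surjective (hC : IsBaseChangeAlong π C C' ιC) {g : B →ₗ[R] C}
    (hg : Function.Surjective g) {g' : B' →ₗ[R'] C'} (hg' : ∀ b, g' (ιB b) = ιC (g b)) :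
    Function.Surjective g' := by
  refine LinearMap.range_eq_top.1 (hC.eq_top_of_mem fun c => ?_)
  obtain ⟨b, rfl⟩ := hg c
  exact ⟨ιB b, hg' b⟩

theorem exact (hA : IsBaseChangeAlong π A A' ιA) (hB : IsBaseChangeAlong π B B' ιB)
    (hC : IsBaseChangeAlong π C C' ιC) {f : A →ₗ[R] B} {g : B →ₗ[R] C}
    (hg : Function.Surjective g) (hfg : Function.Exact f g)
    {f' : A' →ₗ[R'] B'} (hf' : ∀ a, f' (ιA a) = ιB (f a))
    {g' : B' →ₗ[R'] C'} (hg' : ∀ b, g' (ιB b) = ιC (g b)) : Function.Exact f' g' := by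
  let N := LinearMap.range f'
  have key : ∀ b b', g b = g b' → N.mkQ (ιB b) = N.mkQ (ιB b') := fun b b' hb => by
    obtain ⟨a, ha⟩ := (hfg (b - b')).1 (by rw [map_sub, hb, sub_self])
    rw [← sub_eq_zero, ← map_sub, ← map_sub, ← ha, Submodule.mkQ_apply,
      Submodule.Quotient.mk_eq_zero]
    exact ⟨ιA a, hf' a⟩
  choose s hs using hg
  obtain ⟨t, ht⟩ := (hC (B' ⧸ N)
    { toFun := fun c => N.mkQ (ιB (s c))
      map_add' := fun x y => by
        rw [← map_add, ← map_add]
        exact key _ _ (by rw [map_add, hs, hs, hs])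
      map_smul' := fun r x => by
        rw [← map_smul, ← map_smulₛₗ]
        exact key _ _ (by rw [map_smul, hs, hs]) }).exists
  have ht : t.comp g' = N.mkQ := hB.hom_ext fun b => by
    rw [LinearMap.comp_apply, hg', ht]
    exact key _ _ (hs _)
  have hgf : g'.comp f' = 0 := hA.hom_ext fun a => by
    rw [LinearMap.comp_apply, hf', hg', hfg.apply_apply_eq_zero, map_zero, LinearMap.zero_apply]
  refine fun y => ⟨fun hy => ?_, ?_⟩
  · have := LinearMap.congr_fun ht y
    rw [LinearMap.comp_apply, hy, map_zero] at this
    exact (Submodule.Quotient.mk_eq_zero N).1 this.symm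
  · rintro ⟨x, rfl⟩
    exact LinearMap.congr_fun hgf x

theorem isShortExactSeq [Module.Finite R C] (htor : TorOneVanish π C)
    (hA : IsBaseChangeAlong π A A' ιA) (hB : IsBaseChangeAlong π B B' ιB)
    (hC : IsBaseChangeAlong π C C' ιC) {f : A →ₗ[R] B} {g : B →ₗ[R] C}
    (h : IsShortExactSeq f g)
    {f' : A' →ₗ[R'] B'} (hf' : ∀ a, f' (ιA a) = ιB (f a))
    {g' : B' →ₗ[R'] C'} (hg' : ∀ b, g' (ιB b) = ιC (g b)) : IsShortExactSeq f' g' := by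
  refine ⟨?_, hC.surjective h.surj hg', hA.exact hB hC h.surj h.exact hf' hg'⟩
  obtain ⟨k, p, hp⟩ := Module.Finite.exists_fin' R C
  obtain ⟨q, hq⟩ := Module.projective_lifting_property g p h.surj
  have hq : ∀ x, g (q x) = p x := LinearMap.congr_fun hq
  have hqf : ∀ x : LinearMap.ker p, q x ∈ LinearMap.range f := fun x =>
    (h.exact _).1 (by rw [hq]; exact x.2)
  let fe := LinearEquiv.ofInjective f h.inj
  let t : LinearMap.ker p →ₗ[R] A := fe.symm.toLinearMap.comp
    (LinearMap.codRestrict _ (q.comp (LinearMap.ker p).subtype) hqf)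
  have ht : ∀ x, f (t x) = q x := fun x => by
    have : ((fe (t x) : LinearMap.range f) : B) = q x := by
      simp only [t, LinearMap.comp_apply, LinearEquiv.coe_coe, LinearEquiv.apply_symm_apply]
      rfl
    simpa [fe] using this
  have hexact : Function.Exact ((LinearMap.ker p).subtype.prod (-t)) (q.coprod f) := by
    rintro ⟨x, a⟩
    rw [LinearMap.coprod_apply]
    constructor
    · intro hxa
      have hx : p x = 0 := by
        have := congrArg g hxa
        rwa [map_add, hq, h.exact.apply_apply_eq_zero, add_zero, map_zero] at this
      refine ⟨⟨x, hx⟩, Prod.ext rfl (h.inj ?_)⟩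
      change f (-t ⟨x, hx⟩) = f a
      rw [map_neg, ht]
      exact neg_eq_of_add_eq_zero_right hxa
    · rintro ⟨y, hy⟩
      obtain ⟨rfl, rfl⟩ := Prod.ext_iff.1 hy
      simp [ht]
  have hsurj : Function.Surjective (q.coprod f) := fun b => by
    obtain ⟨x, hx⟩ := hp (g b)
    obtain ⟨a, ha⟩ := (h.exact (b - q x)).1 (by rw [map_sub, hq, hx, sub_self])
    exact ⟨(x, a), by rw [LinearMap.coprod_apply, ha, add_sub_cancel]⟩
  obtain ⟨N', _, _, ιN, hN⟩ := exists_isBaseChangeAlong π (LinearMap.ker p)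
  obtain ⟨ιF, hF⟩ : ∃ ιF, IsBaseChangeAlong π (Fin k → R) (Fin k → R') ιF := ⟨_, pi_fin π k⟩
  obtain ⟨ιFA, hFA, hFA'⟩ := hF.exists_prod hA
  obtain ⟨Φ, hΦ⟩ := hN.exists_map ιFA ((LinearMap.ker p).subtype.prod (-t))
  obtain ⟨Ψ, hΨ⟩ := hFA.exists_map ιB (q.coprod f)
  have hΨf : Ψ.comp (LinearMap.inr R' _ A') = f' := hA.hom_ext fun a => by
    rw [hf']
    simpa [hFA'] using hΨ (0, a)
  have hfst := htor k _ _ p Subtype.val_injective hp (LinearMap.exact_subtype_ker_map p) N' ιN hN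
    _ _ hF ((LinearMap.fst R' _ A').comp Φ)
    (fun x => by rw [LinearMap.comp_apply, hΦ, hFA']; rfl)
  rw [injective_iff_map_eq_zero]
  intro a ha
  rw [← hΨf] at ha
  obtain ⟨x, hx⟩ := (hN.exact hFA hB hsurj hexact hΦ hΨ _).1 ha
  have hx0 : x = 0 := hfst (by rw [LinearMap.comp_apply, hx, map_zero]; rfl)
  rw [hx0, map_zero] at hx
  exact (congrArg Prod.snd hx).symm

theorem pdLE_one (htor : TorOneVanish π A) (hA : IsBaseChangeAlong π A A' ιA)
    (hpd : PdLE R 1 A) : PdLE R' 1 A' := by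
  obtain ⟨k, f, hf, hL⟩ := hpd
  have hL : Module.Projective R (LinearMap.ker f) := hL
  have : Module.Finite R A := Module.Finite.of_surjective f hf
  obtain ⟨L', _, _, ιL, hL'⟩ := exists_isBaseChangeAlong π (LinearMap.ker f)
  obtain ⟨ιF, hF⟩ : ∃ ιF, IsBaseChangeAlong π (Fin k → R) (Fin k → R') ιF := ⟨_, pi_fin π k⟩
  obtain ⟨i', hi'⟩ := hL'.exists_map ιF (LinearMap.ker f).subtype
  obtain ⟨f', hf'⟩ := hF.exists_map ιA f
  have h := hL'.isShortExactSeq htor hF hA (isShortExactSeq_ker hf) hi' hf'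
  have := hL'.projective
  refine ⟨k, f', h.surj, Module.Projective.of_equiv ((LinearEquiv.ofInjective i' h.inj).trans
    (LinearEquiv.ofEq _ _ h.exact.linearMap_ker_eq.symm))⟩

theorem isStep {neg : Bool} [Module.Finite R A] [Module.Finite R C] (htorA : TorOneVanish π A)
    (htorC : TorOneVanish π C) (hA : IsBaseChangeAlong π A A' ιA)
    (hB : IsBaseChangeAlong π B B' ιB) (hC : IsBaseChangeAlong π C C' ιC)
    (h : IsStep R neg A B C) : IsStep R' neg A' B' C' := by
  cases neg
  · obtain ⟨f, g, h⟩ := h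
    obtain ⟨f', hf'⟩ := hC.exists_map ιB f
    obtain ⟨g', hg'⟩ := hB.exists_map ιA g
    exact ⟨f', g', hC.isShortExactSeq htorA hB hA h hf' hg'⟩
  · obtain ⟨f, g, h⟩ := h
    obtain ⟨f', hf'⟩ := hA.exists_map ιB f
    obtain ⟨g', hg'⟩ := hB.exists_map ιC g
    exact ⟨f', g', hA.isShortExactSeq htorC hB hC h hf' hg'⟩

end IsBaseChangeAlong

theorem ShiftChain.baseChange {S : Submonoid R} {S' : Submonoid R'}
    (hbc : ∀ (M : Type) [AddCommGroup M] [Module R M], MemC R S M →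
      ∀ (B : Type) [AddCommGroup B] [Module R' B] (ιB : M →ₛₗ[π] B),
        IsBaseChangeAlong π M B ιB → MemC R' S' B)
    (htor : ∀ (M : Type) [AddCommGroup M] [Module R M], MemC R S M → TorOneVanish π M)
    {Ω Ω' : Type} [CommMonoid Ω] [CommMonoid Ω']
    {F : (M : Type) → [AddCommGroup M] → [Module R M] → Ω}
    {F' : (M : Type) → [AddCommGroup M] → [Module R' M] → Ω'} {ϖ : Ω →* Ω'}
    (hcompat : ∀ (M : Type) [AddCommGroup M] [Module R M], MemC R S M →
      ∀ (B : Type) [AddCommGroup B] [Module R' B] (ιB : M →ₛₗ[π] B),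
        IsBaseChangeAlong π M B ιB → ϖ (F M) = F' B)
    {neg : Bool} {n : ℕ} {M : Type} [AddCommGroup M] [Module R M] (hM : MemC R S M)
    {B : Type} [AddCommGroup B] [Module R' B] {ιB : M →ₛₗ[π] B}
    (hB : IsBaseChangeAlong π M B ιB) {ω : Ω} (hω : ShiftChain R S F neg n M ω) :
    ShiftChain R' S' F' neg n B (ϖ ω) := by
  induction n generalizing M B ω with
  | zero => exact (congrArg ϖ hω).trans (hcompat M hM B ιB hB)
  | succ n ih =>
    obtain ⟨P, K, _, _, _, _, h, hPC, hP, hK, U, hU, ω₀, hω₀, rfl⟩ := hω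
    obtain ⟨P', _, _, ιP, hP'⟩ := exists_isBaseChangeAlong π P
    obtain ⟨K', _, _, ιK, hK'⟩ := exists_isBaseChangeAlong π K
    have := hM.1.1
    have := hK.1.1
    have hPC' := hbc P hPC P' ιP hP'
    refine ⟨P', K', _, _, _, _, hB.isStep (htor _ hM) (htor _ hK) hP' hK' h, hPC',
      ⟨hPC'.1, hP'.pdLE_one (htor _ hPC) hP.2⟩, hbc K hK K' ιK hK', Units.map ϖ U, ?_, _,
      ih hK hK' hω₀, ?_⟩
    · rw [Units.coe_map, hU, hcompat P hPC P' ιP hP']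
    · rw [map_mul, ← map_zpow, Units.coe_map]

end BaseChange

/-- Functoriality of shifts: given `π : R → R'` such that base change
along `π` carries `𝓒_{R,S}` into `𝓒_{R',S'}` with vanishing `Tor₁`, quasi-Fitting
invariants `𝓕_R`, `𝓕_{R'}` and a monoid homomorphism `ϖ` with
`ϖ(𝓕_R(M)) = 𝓕_{R'}(R' ⊗_R M)` on `𝓒_{R,S}`, one has
`ϖ(𝓕_R⟨n⟩(M)) = 𝓕_{R'}⟨n⟩(R' ⊗_R M)` for all `M ∈ 𝓒_{R,S}` and all `n ∈ ℤ`. -/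
theorem statement14
    (R : Type) [Ring R] [IsNoetherianRing R] [IsNoetherianRing Rᵐᵒᵖ]
    (S : Submonoid R) (hS : IsOreSet R S) (hstar : AssumptionStar R)
    (R' : Type) [Ring R'] [IsNoetherianRing R'] [IsNoetherianRing R'ᵐᵒᵖ]
    (S' : Submonoid R') (hS' : IsOreSet R' S') (hstar' : AssumptionStar R')
    (π : R →+* R')
    (hbc : ∀ (M : Type) [AddCommGroup M] [Module R M], MemC R S M →
      ∀ (B : Type) [AddCommGroup B] [Module R' B] (ιB : M →ₛₗ[π] B),
        IsBaseChangeAlong π M B ιB → MemC R' S' B)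
    (htor : ∀ (M : Type) [AddCommGroup M] [Module R M], MemC R S M → TorOneVanish π M)
    (Ω Ω' : Type) [CommMonoid Ω] [CommMonoid Ω']
    (F : (M : Type) → [AddCommGroup M] → [Module R M] → Ω)
    (F' : (M : Type) → [AddCommGroup M] → [Module R' M] → Ω')
    (hF : IsQuasiFittingInv R S F) (hF' : IsQuasiFittingInv R' S' F')
    (ϖ : Ω →* Ω')
    (hcompat : ∀ (M : Type) [AddCommGroup M] [Module R M], MemC R S M →
      ∀ (B : Type) [AddCommGroup B] [Module R' B] (ιB : M →ₛₗ[π] B),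
        IsBaseChangeAlong π M B ιB → ϖ (F M) = F' B)
    (n : ℤ) (M : Type) [AddCommGroup M] [Module R M] (hM : MemC R S M)
    (B : Type) [AddCommGroup B] [Module R' B] (ιB : M →ₛₗ[π] B)
    (hB : IsBaseChangeAlong π M B ιB)
    (ω : Ω) (ω' : Ω')
    (hω : ShiftValue R S (MemCFam R S) F n M ω)
    (hω' : ShiftValue R' S' (MemCFam R' S') F' n B ω') :
    ϖ ω = ω' := by
  exact ((hω.shiftChain hF).baseChange hbc htor hcompat hM hB).unique hF' (hω'.shiftChain hF')
end

section
/- Let p be a prime, d ≥ 1, Λ = ℤ_p[[T_1, …, T_d]] the ring of formal power series in d variables over the p-adic integers, and I = (T_1, …, T_d) the ideal generated by the variables. Let M be a finitely generated Λ-module with pd_Λ(M) ≤ 1 such that every element of M is annihilated by some f ∈ Λ ∖ I. Then Tor_1^Λ(Λ/I, M) = 0, and M/IM is a finite (ℤ_p-torsion) module. -/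
open CategoryTheory MulOpposite

/-- The Iwasawa algebra `Λ = ℤ_p[[T₁, …, T_d]]`. -/
abbrev PSL (p d : ℕ) [Fact p.Prime] : Type := MvPowerSeries (Fin d) ℤ_[p]

/-- The ideal `I = (T₁, …, T_d)` of `Λ`. -/
noncomputable abbrev PSI (p d : ℕ) [Fact p.Prime] : Ideal (PSL p d) :=
  Ideal.span (Set.range (MvPowerSeries.X : Fin d → PSL p d))

/-- Over a prime ideal `I`, scalars outside `I` act injectively on `N / IN` for `N` projective. -/
theorem Module.Projective.mem_smul_top_of_smul_mem {R N : Type*} [CommRing R] [AddCommGroup N]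
    [Module R N] [Module.Projective R N] {I : Ideal R} (hI : I.IsPrime) {s : R} (hs : s ∉ I)
    {x : N} (hx : s • x ∈ I • (⊤ : Submodule R N)) : x ∈ I • (⊤ : Submodule R N) := by
  obtain ⟨g, hg⟩ := Module.projective_def'.1 (inferInstance : Module.Projective R N)
  have hcoord (n : N) : g x n ∈ I := by
    have h := Submodule.smul_top_le_comap_smul_top I ((Finsupp.lapply n).comp g) hx
    simp only [smul_eq_mul, Ideal.mul_top, Submodule.mem_comap, map_smul, LinearMap.comp_apply,
      Finsupp.lapply_apply] at h
    exact (hI.mem_or_mem h).resolve_left hs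
  have hgx : Finsupp.linearCombination R id (g x) = x := LinearMap.congr_fun hg x
  rw [← hgx, Finsupp.linearCombination_apply]
  exact Submodule.sum_mem _ fun n _ => Submodule.smul_mem_smul (hcoord n) trivial

/-- Schanuel's lemma: if one presentation of `M` by projectives has a projective kernel, then so
does every other one. -/
theorem Module.Projective.of_exact_of_projective_ker {R M F F' N : Type*} [Ring R]
    [AddCommGroup M] [Module R M] [AddCommGroup F] [Module R F] [AddCommGroup F'] [Module R F']
    [AddCommGroup N] [Module R N] [Module.Projective R F] [Module.Projective R F']
    {f : F' →ₗ[R] M} (hf : Function.Surjective f) [Module.Projective R (LinearMap.ker f)]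
    {ι : N →ₗ[R] F} {π : F →ₗ[R] M} (hι : Function.Injective ι) (hπ : Function.Surjective π)
    (hex : Function.Exact ι π) : Module.Projective R N := by
  obtain ⟨α, hα⟩ := Module.projective_lifting_property f π hf
  obtain ⟨β, hβ⟩ := Module.projective_lifting_property π f hπ
  have hα' (a : F) : f (α a) = π a := LinearMap.congr_fun hα a
  have hβ' (b : F') : π (β b) = f b := LinearMap.congr_fun hβ b
  let e : N ≃ₗ[R] LinearMap.ker π :=
    (LinearEquiv.ofInjective ι hι).trans (LinearEquiv.ofEq _ _ (LinearMap.exact_iff.1 hex).symm)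
  have he (n : N) : (e n : F) = ι n := rfl
  let i : N →ₗ[R] LinearMap.ker f × F :=
    ((α.comp ι).codRestrict (LinearMap.ker f) fun n => by
      simp [hα', hex.apply_apply_eq_zero]).prod ι
  let q : LinearMap.ker f × F →ₗ[R] LinearMap.ker π :=
    ((β.comp (LinearMap.ker f).subtype).coprod (LinearMap.id - β.comp α)).codRestrict
      (LinearMap.ker π) fun y => by simp [hα', hβ']
  refine Module.Projective.of_split i (e.symm.toLinearMap.comp q) (LinearMap.ext fun n => ?_)
  apply e.injective
  ext
  simp only [LinearMap.comp_apply, LinearEquiv.coe_coe, LinearEquiv.apply_symm_apply,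
    LinearMap.id_apply, he]
  exact add_sub_cancel (β (α (ι n))) (ι n)

/-- If every element of a finitely generated module is killed by a scalar outside the prime `I`,
then one scalar outside `I` kills the whole module. -/
theorem Module.Finite.exists_notMem_forall_smul_eq_zero {R M : Type*} [CommRing R]
    [AddCommGroup M] [Module R M] [Module.Finite R M] {I : Ideal R} (hI : I.IsPrime)
    (h : ∀ m : M, ∃ s : R, s ∉ I ∧ s • m = 0) : ∃ s : R, s ∉ I ∧ ∀ m : M, s • m = 0 := by
  obtain ⟨S, hS⟩ := (inferInstance : Module.Finite R M)
  choose t ht htm using h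
  refine ⟨∏ m ∈ S, t m, fun hmem => ?_, fun m => ?_⟩
  · obtain ⟨m, -, hm⟩ := hI.prod_mem_iff.1 hmem
    exact ht m hm
  · have hm : m ∈ Submodule.span R (S : Set M) := hS ▸ trivial
    induction hm using Submodule.span_induction with
    | mem x hx =>
      obtain ⟨c, hc⟩ := Finset.dvd_prod_of_mem t hx
      rw [hc, mul_comm, mul_smul, htm, smul_zero]
    | zero => exact smul_zero _
    | add x y _ _ hx hy => rw [smul_add, hx, hy, add_zero]
    | smul a x _ hx => rw [smul_comm, hx, smul_zero]

/-- In finitely many variables, the power series without constant term form the ideal generated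
by the variables. -/
theorem MvPowerSeries.span_range_X_eq_ker_constantCoeff (σ R : Type*) [Finite σ] [CommRing R] :
    Ideal.span (Set.range (X : σ → MvPowerSeries σ R)) =
      RingHom.ker (constantCoeff (σ := σ) (R := R)) := by
  classical
  cases nonempty_fintype σ
  refine le_antisymm (Ideal.span_le.2 ?_) fun φ hφ => ?_
  · rintro _ ⟨i, rfl⟩
    simp [RingHom.mem_ker]
  · have hne (n : σ →₀ ℕ) (hn : n ≠ 0) : ∃ i, n i ≠ 0 := by
      simpa [DFunLike.ext_iff] using hn
    choose c hc using hne
    let ψ (i : σ) : MvPowerSeries σ R :=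
      fun n => if hn : n = 0 then 0 else if c n hn = i then coeff n φ else 0
    have hψ (i : σ) (n : σ →₀ ℕ) : coeff n (ψ i) =
      if hn : n = 0 then 0 else if c n hn = i then coeff n φ else 0 := rfl
    have hsum : φ = ∑ i, ψ i := by
      ext n
      rw [map_sum]
      simp only [hψ]
      by_cases hn : n = 0
      · subst hn
        simpa using RingHom.mem_ker.1 hφ
      · simp [hn]
    rw [hsum]
    refine Ideal.sum_mem _ fun i _ => ?_
    refine Ideal.mem_of_dvd _ (X_dvd_iff.2 fun n hn => ?_) (Ideal.subset_span ⟨i, rfl⟩)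
    rw [hψ]
    split_ifs with h0 hi
    · rfl
    · exact absurd (hi ▸ hn) (hc n h0)
    · rfl

/-- Let `Λ = ℤ_p[[T₁, …, T_d]]` (`d ≥ 1`), `I = (T₁, …, T_d)`.  If `M`
is a finitely generated `Λ`-module with `pd_Λ(M) ≤ 1` such that every element of `M` is
annihilated by some `f ∈ Λ ∖ I`, then `Tor₁^Λ(Λ/I, M) = 0` (for every presentation
`0 → N → F → M → 0` with `F` finite free, the induced map `N/IN → F/IF` is injective)
and `M/IM` is a finite module. -/
theorem statement15 (p : ℕ) [Fact p.Prime] (d : ℕ) (hd : 1 ≤ d)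
    (M : Type) [AddCommGroup M] [Module (PSL p d) M]
    (hfg : Module.Finite (PSL p d) M) (hpd : PdLE (PSL p d) 1 M)
    (htors : ∀ m : M, ∃ f : PSL p d, f ∉ PSI p d ∧ f • m = 0) :
    (∀ (k : ℕ) (N : Type) [AddCommGroup N] [Module (PSL p d) N]
      (ι : N →ₗ[PSL p d] (Fin k → PSL p d)) (π : (Fin k → PSL p d) →ₗ[PSL p d] M),
      Function.Injective ι → Function.Surjective π → Function.Exact ι π →
      ∀ h : (N ⧸ (PSI p d • (⊤ : Submodule (PSL p d) N)))
          →ₗ[PSL p d] ((Fin k → PSL p d) ⧸ (PSI p d • (⊤ : Submodule (PSL p d) (Fin k → PSL p d)))),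
        (∀ x : N, h (Submodule.Quotient.mk x) = Submodule.Quotient.mk (ι x)) →
        Function.Injective h) ∧
    Finite (M ⧸ (PSI p d • (⊤ : Submodule (PSL p d) M))) := by
  have hker : PSI p d = RingHom.ker (MvPowerSeries.constantCoeff (σ := Fin d) (R := ℤ_[p])) :=
    MvPowerSeries.span_range_X_eq_ker_constantCoeff _ _
  have hI : (PSI p d).IsPrime := hker ▸ RingHom.ker_isPrime _
  obtain ⟨s, hs, hsM⟩ := Module.Finite.exists_notMem_forall_smul_eq_zero hI htors
  constructor
  · intro k N _ _ ι π hι hπ hex h hh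
    obtain ⟨l, f, hf, hfp⟩ := hpd
    have : Module.Projective (PSL p d) (LinearMap.ker f) := hfp
    have : Module.Projective (PSL p d) N :=
      Module.Projective.of_exact_of_projective_ker hf hι hπ hex
    let e : N ≃ₗ[PSL p d] LinearMap.ker π :=
      (LinearEquiv.ofInjective ι hι).trans (LinearEquiv.ofEq _ _ (LinearMap.exact_iff.1 hex).symm)
    let σ : (Fin k → PSL p d) →ₗ[PSL p d] N := e.symm.toLinearMap.comp
      ((LinearMap.lsmul (PSL p d) _ s).codRestrict (LinearMap.ker π) fun v => by simp [hsM])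
    have hσ (n : N) : σ (ι n) = s • n := by
      apply e.injective
      ext1
      simp only [σ, LinearMap.comp_apply, LinearEquiv.coe_coe, LinearEquiv.apply_symm_apply,
        map_smul]
      rfl
    refine (injective_iff_map_eq_zero h).2 fun y hy => ?_
    obtain ⟨x, rfl⟩ := Submodule.Quotient.mk_surjective _ y
    rw [hh, Submodule.Quotient.mk_eq_zero] at hy
    rw [Submodule.Quotient.mk_eq_zero]
    refine Module.Projective.mem_smul_top_of_smul_mem hI hs ?_
    rw [← hσ]
    exact Submodule.smul_top_le_comap_smul_top _ σ hy
  · have hs0 : MvPowerSeries.constantCoeff s ≠ 0 := by rwa [hker, RingHom.mem_ker] at hs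
    obtain ⟨n, hn⟩ := PadicInt.ideal_eq_span_pow_p (p := p)
      (mt Ideal.span_singleton_eq_bot.1 hs0)
    let φ : PSL p d →+* ZMod (p ^ n) := (PadicInt.toZModPow n).comp MvPowerSeries.constantCoeff
    have : NeZero (p ^ n) := ⟨pow_ne_zero _ (Fact.out : p.Prime).ne_zero⟩
    have : Finite (PSL p d ⧸ RingHom.ker φ) := Finite.of_injective _ φ.kerLift_injective
    have hle : RingHom.ker φ • (⊤ : Submodule (PSL p d) M) ≤ PSI p d • ⊤ := by
      refine Submodule.smul_le.2 fun r hr m _ => ?_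
      have hr' : MvPowerSeries.constantCoeff r ∈
          Ideal.span {MvPowerSeries.constantCoeff s} := by
        rw [hn, ← PadicInt.ker_toZModPow]
        exact hr
      obtain ⟨t, ht⟩ := Ideal.mem_span_singleton.1 hr'
      have hmem : r - s * MvPowerSeries.C t ∈ PSI p d := by
        rw [hker, RingHom.mem_ker]
        simp [ht]
      have hrm : r • m = (r - s * MvPowerSeries.C t) • m := by
        rw [sub_smul, mul_smul, hsM, sub_zero]
      rw [hrm]
      exact Submodule.smul_mem_smul hmem trivial
    have : Finite (M ⧸ (RingHom.ker φ • (⊤ : Submodule (PSL p d) M))) :=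
      Submodule.finite_quotient_smul _ hfg.fg_top
    exact Finite.of_surjective _ (Submodule.factor_surjective hle)
end

section
/- Let R be a commutative noetherian ring and S a multiplicative subset of R consisting of non-zero-divisors. If P is a finitely generated S-torsion R-module with pd_R(P) ≤ 1, then Fitt_R(Ext^1_R(P, R)) = Fitt_R(P). -/
open CategoryTheory MulOpposite

section FittingIdeal

variable {R M : Type} [CommRing R] [AddCommGroup M] [Module R M]

/-- Determinants of relation matrices indexed by any finite type lie in the Fitting ideal. -/
lemma det_mem_fittingIdeal {κ : Type} [Fintype κ] [DecidableEq κ] (A : Matrix κ κ R)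
    (π : (κ → R) →ₗ[R] M) (hπ : Function.Surjective π) (hA : ∀ j, π (A.col j) = 0) :
    A.det ∈ fittingIdeal R M := by
  let e := Fintype.equivFin κ
  refine Ideal.subset_span ⟨Fintype.card κ, A.submatrix e.symm e.symm,
    π ∘ₗ LinearMap.funLeft R R e, ?_, fun j => ?_, ?_⟩
  · exact hπ.comp (LinearMap.funLeft_surjective_of_injective R R e e.injective)
  · rw [← hA (e.symm j)]
    simp only [LinearMap.comp_apply]
    congr 1
    ext i
    simp [LinearMap.funLeft_apply, Matrix.col_apply]
  · rw [Matrix.det_submatrix_equiv_self]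

/-- If `φ` is surjective up to multiplication by `s`, then the determinant of a matrix of
relations of `φ` lies in the Fitting ideal up to a power of `s`. -/
lemma exists_pow_mul_det_mem_fittingIdeal [Module.Finite R M] {k : ℕ}
    (φ : (Fin k → R) →ₗ[R] M) (C : Matrix (Fin k) (Fin k) R) (s : R)
    (hφ : ∀ m, ∃ x, φ x = s • m) (hC : ∀ j, φ (C.col j) = 0) :
    ∃ n : ℕ, s ^ n * C.det ∈ fittingIdeal R M := by
  obtain ⟨n, ψ, hψ⟩ := Module.Finite.exists_fin' R M
  choose g hg using fun j : Fin n => hφ (ψ (Pi.single j 1))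
  refine ⟨n, ?_⟩
  have hdet : s ^ n * C.det = (Matrix.fromBlocks C (Matrix.of fun i j => - g j i) 0
      (s • (1 : Matrix (Fin n) (Fin n) R))).det := by
    rw [Matrix.det_fromBlocks_zero₂₁, Matrix.det_smul]
    simp [mul_comm]
  rw [hdet]
  refine det_mem_fittingIdeal _
    (φ ∘ₗ LinearMap.funLeft R R Sum.inl + ψ ∘ₗ LinearMap.funLeft R R Sum.inr) ?_ ?_
  · intro m
    obtain ⟨y, rfl⟩ := hψ m
    refine ⟨Sum.elim 0 y, ?_⟩
    have h1 : LinearMap.funLeft R R Sum.inl (Sum.elim (0 : Fin k → R) y) = 0 := rfl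
    have h2 : LinearMap.funLeft R R Sum.inr (Sum.elim (0 : Fin k → R) y) = y := rfl
    simp [h1, h2]
  · rintro (j | j)
    · have h2 : (LinearMap.funLeft R R Sum.inr) ((Matrix.fromBlocks C
          (Matrix.of fun i j => - g j i) 0 (s • (1 : Matrix (Fin n) (Fin n) R))).col
          (Sum.inl j)) = 0 := rfl
      simp only [LinearMap.add_apply, LinearMap.comp_apply, h2, map_zero, add_zero]
      exact hC j
    · have h1 : (LinearMap.funLeft R R Sum.inl) ((Matrix.fromBlocks C
          (Matrix.of fun i j => - g j i) 0 (s • (1 : Matrix (Fin n) (Fin n) R))).col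
          (Sum.inr j)) = - g j := rfl
      have h2 : (LinearMap.funLeft R R Sum.inr) ((Matrix.fromBlocks C
          (Matrix.of fun i j => - g j i) 0 (s • (1 : Matrix (Fin n) (Fin n) R))).col
          (Sum.inr j)) = s • Pi.single j 1 := by
        ext i
        simp [LinearMap.funLeft_apply, Matrix.col_apply, Matrix.one_apply, Pi.single_apply]
      simp only [LinearMap.add_apply, LinearMap.comp_apply, h1, h2, map_neg, map_smul, hg]
      simp

/-- If `φ` is surjective up to `s` and its relations are, up to `s`, combinations of the columns
of `C`, then the Fitting ideal is contained in `(det C)` up to a power of `s`. -/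
lemma pow_mul_mem_span_det_of_mem_fittingIdeal {k : ℕ}
    (φ : (Fin k → R) →ₗ[R] M) (C : Matrix (Fin k) (Fin k) R) (s : R)
    (hφ : ∀ m, ∃ x, φ x = s • m) (hC : ∀ x, φ x = 0 → ∃ y, s • x = C.mulVec y)
    {x : R} (hx : x ∈ fittingIdeal R M) :
    s ^ (2 * k) * x ∈ Ideal.span {C.det} := by
  induction hx using Submodule.span_induction with
  | zero => simp
  | add x y _ _ hx hy => rw [mul_add]; exact add_mem hx hy
  | smul r x _ hx =>
    rw [smul_eq_mul, mul_left_comm]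
    exact Ideal.mul_mem_left _ _ hx
  | mem x hx =>
    obtain ⟨b, A, π, hπ, hA, rfl⟩ := hx
    choose h hh using fun i : Fin k => hπ (φ (Pi.single i 1))
    choose g hg using fun j : Fin b => hφ (π (Pi.single j 1))
    let H : Matrix (Fin b) (Fin k) R := Matrix.of fun i j => h j i
    let G : Matrix (Fin k) (Fin b) R := Matrix.of fun i j => g j i
    have hHφ : ∀ x, π (H.mulVec x) = φ x := by
      have : π ∘ₗ H.mulVecLin = φ := by
        refine LinearMap.pi_ext' fun i => LinearMap.ext_ring ?_
        change π (H.mulVec (Pi.single i 1)) = φ (Pi.single i 1)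
        rw [Matrix.mulVec_single_one]
        exact hh i
      exact fun x => LinearMap.congr_fun this x
    have hGφ : ∀ x, φ (G.mulVec x) = s • π x := by
      have : φ ∘ₗ G.mulVecLin = s • π := by
        refine LinearMap.pi_ext' fun i => LinearMap.ext_ring ?_
        change φ (G.mulVec (Pi.single i 1)) = s • π (Pi.single i 1)
        rw [Matrix.mulVec_single_one]
        exact hg i
      exact fun x => LinearMap.congr_fun this x
    have h1 : ∀ j, φ ((G * A).col j) = 0 := fun j => by
      have : (G * A).col j = G.mulVec (fun i => A i j) := rfl
      rw [this, hGφ, hA, smul_zero]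
    have h2 : ∀ j, φ ((s • (1 : Matrix (Fin k) (Fin k) R) - G * H).col j) = 0 := fun j => by
      have : (s • (1 : Matrix (Fin k) (Fin k) R) - G * H).col j
          = s • Pi.single j 1 - G.mulVec (H.mulVec (Pi.single j 1)) := by
        rw [Matrix.mulVec_mulVec]
        ext i
        simp [Matrix.col_apply, Matrix.one_apply, Pi.single_apply]
      rw [this, map_sub, hGφ, hHφ, map_smul, sub_self]
    choose d₁ hd₁ using fun j => hC _ (h1 j)
    choose d₂ hd₂ using fun j => hC _ (h2 j)
    let D₁ : Matrix (Fin k) (Fin b) R := Matrix.of fun i j => d₁ j i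
    let D₂ : Matrix (Fin k) (Fin k) R := Matrix.of fun i j => d₂ j i
    have hD₁ : s • (G * A) = C * D₁ := by
      ext i j
      exact congrFun (hd₁ j) i
    have hD₂ : s • (s • (1 : Matrix (Fin k) (Fin k) R) - G * H) = C * D₂ := by
      ext i j
      exact congrFun (hd₂ j) i
    have key : Matrix.fromBlocks 1 0 (s • G) ((s * s) • (1 : Matrix (Fin k) (Fin k) R)) *
        Matrix.fromBlocks A (-H) 0 1 =
        Matrix.fromBlocks 1 0 0 C * Matrix.fromBlocks A (-H) D₁ D₂ := by
      rw [Matrix.fromBlocks_multiply, Matrix.fromBlocks_multiply]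
      simp only [Matrix.one_mul, Matrix.zero_mul, add_zero, zero_add, Matrix.mul_one,
        Matrix.mul_zero, ← hD₁, ← hD₂, Matrix.smul_mul, smul_sub, smul_smul, Matrix.mul_neg]
      congr 1
      abel
    have hdet := congrArg Matrix.det key
    rw [Matrix.det_mul, Matrix.det_mul, Matrix.det_fromBlocks_zero₁₂,
      Matrix.det_fromBlocks_zero₂₁, Matrix.det_fromBlocks_zero₁₂, Matrix.det_smul] at hdet
    simp only [Matrix.det_one, one_mul, mul_one, Fintype.card_fin] at hdet
    rw [two_mul, pow_add, ← mul_pow, hdet]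
    exact Ideal.mul_mem_right _ _ (Ideal.mem_span_singleton_self _)

end FittingIdeal

section Local

variable {R : Type} [CommRing R]

/-- Up to powers of an element outside `p`, a finitely presented projective module is free. -/
lemma exists_notMem_comp_eq_smul_id {N : Type} [AddCommGroup N] [Module R N]
    [Module.FinitePresentation R N] [Module.Projective R N] (p : Ideal R) [p.IsPrime] :
    ∃ (r : ℕ) (s : R) (u : (Fin r → R) →ₗ[R] N) (v : N →ₗ[R] (Fin r → R)),
      s ∉ p ∧ u ∘ₗ v = s • LinearMap.id ∧ v ∘ₗ u = s • LinearMap.id := by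
  let Rp := Localization.AtPrime p
  let Np := LocalizedModule p.primeCompl N
  let g := LocalizedModule.mkLinearMap p.primeCompl N
  have : Module.Projective Rp Np := Module.projective_of_isLocalizedModule p.primeCompl g
  have : Module.Finite Rp Np := Module.Finite.of_isLocalizedModule p.primeCompl g
  have : Module.Free Rp Np := Module.free_of_flat_of_isLocalRing
  let r := Module.finrank Rp Np
  let l : (Fin r → Rp) ≃ₗ[R] Np :=
    (Module.finBasis Rp Np).equivFun.symm.restrictScalars R
  let f : (Fin r → R) →ₗ[R] (Fin r → Rp) := 
    LinearMap.pi fun i => Algebra.linearMap R Rp ∘ₗ LinearMap.proj i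
  have : IsLocalizedModule p.primeCompl f := IsLocalizedModule.pi p.primeCompl _
  obtain ⟨h, s, hh⟩ := Module.FinitePresentation.exists_lift_of_isLocalizedModule p.primeCompl g
    (l.toLinearMap ∘ₗ f)
  obtain ⟨h', s', hh'⟩ := Module.FinitePresentation.exists_lift_of_isLocalizedModule p.primeCompl f
    (l.symm.toLinearMap ∘ₗ g)
  have hx : ∀ x, g (h x) = (s : R) • l (f x) := fun x => LinearMap.congr_fun hh x
  have hx' : ∀ x, f (h' x) = (s' : R) • l.symm (g x) := fun x => LinearMap.congr_fun hh' x
  obtain ⟨t, ht⟩ := Module.Finite.exists_smul_of_comp_eq_of_isLocalizedModule p.primeCompl g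
    (h ∘ₗ h') (((s * s' : p.primeCompl) : R) • LinearMap.id) (by
      ext x
      simp [hx, hx', mul_smul])
  obtain ⟨t', ht'⟩ := Module.Finite.exists_smul_of_comp_eq_of_isLocalizedModule p.primeCompl f
    (h' ∘ₗ h) (((s * s' : p.primeCompl) : R) • LinearMap.id) (by
      refine LinearMap.ext fun x => ?_
      simp only [LinearMap.comp_apply, hx, hx', map_smul, LinearEquiv.symm_apply_apply,
        LinearMap.smul_apply, LinearMap.id_apply, Submonoid.coe_mul, mul_smul]
      rw [smul_comm])
  refine ⟨r, (t * t' * (s * s') : p.primeCompl), h, ((t * t' : p.primeCompl) : R) • h',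
    (t * t' * (s * s')).2, ?_, ?_⟩
  · ext x
    have := LinearMap.congr_fun ht x
    simp only [LinearMap.smul_apply, Submonoid.smul_def, LinearMap.comp_apply,
      LinearMap.id_apply] at this
    simp only [LinearMap.comp_apply, LinearMap.smul_apply, map_smul, LinearMap.id_apply]
    rw [Submonoid.coe_mul, mul_comm, mul_smul, this, Submonoid.coe_mul, Submonoid.coe_mul,
      smul_smul, smul_smul]
    congr 1
    push_cast
    ring
  · refine LinearMap.ext fun x => ?_
    have := LinearMap.congr_fun ht' x
    simp only [LinearMap.smul_apply, Submonoid.smul_def, LinearMap.comp_apply,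
      LinearMap.id_apply] at this
    simp only [LinearMap.comp_apply, LinearMap.smul_apply, LinearMap.id_apply]
    rw [Submonoid.coe_mul, mul_smul, this, smul_smul, smul_smul]
    rfl

/-- Two free modules that are isomorphic up to a non-nilpotent scalar have the same rank. -/
lemma eq_of_comp_eq_smul_id {r k : ℕ} (c : R) (hc : ¬ IsNilpotent c)
    (X : (Fin r → R) →ₗ[R] (Fin k → R)) (Y : (Fin k → R) →ₗ[R] (Fin r → R))
    (hXY : X ∘ₗ Y = c • LinearMap.id) (hYX : Y ∘ₗ X = c • LinearMap.id) : r = k := by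
  let Rc := Localization.Away c
  have : Nontrivial Rc := by
    by_contra h
    rw [not_nontrivial_iff_subsingleton] at h
    obtain ⟨n, hn⟩ := (IsLocalization.subsingleton_iff (M := Submonoid.powers c) (S := Rc)).mp h
    exact hc ⟨n, hn⟩
  let F := algebraMap R Rc
  obtain ⟨d, hd⟩ := (IsLocalization.Away.algebraMap_isUnit (S := Rc) c).exists_right_inv
  have h1 : LinearMap.toMatrix' X * LinearMap.toMatrix' Y = c • 1 := by
    rw [← LinearMap.toMatrix'_comp, hXY, map_smul, LinearMap.toMatrix'_id]
  have h2 : LinearMap.toMatrix' Y * LinearMap.toMatrix' X = c • 1 := by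
    rw [← LinearMap.toMatrix'_comp, hYX, map_smul, LinearMap.toMatrix'_id]
  have h3 := congrArg (fun A => d • A.map F) h1
  have h4 := congrArg (fun A => d • A.map F) h2
  have hone : ∀ n : ℕ, d • (c • (1 : Matrix (Fin n) (Fin n) R)).map F = 1 := fun n => by
    ext i j
    by_cases hij : i = j
    · subst hij
      simp [F, mul_comm d, hd]
    · simp [hij]
  simp only [hone, Matrix.map_mul] at h3 h4
  have := Matrix.square_of_invertible ((LinearMap.toMatrix' X).map F)
    (d • (LinearMap.toMatrix' Y).map F) (by rw [Matrix.mul_smul, h3])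
    (by rw [Matrix.smul_mul, h4])
  simpa using this.symm

end Local

section Presentation

variable {R : Type} [CommRing R]

/-- A module of projective dimension at most one has projective first syzygies. -/
lemma PdLE.projective_of_exact {P : Type} [AddCommGroup P] [Module R P] (hpd : PdLE R 1 P)
    {k : ℕ} {N : Type} [AddCommGroup N] [Module R N]
    (ι : N →ₗ[R] (Fin k → R)) (π : (Fin k → R) →ₗ[R] P)
    (hι : Function.Injective ι) (hπ : Function.Surjective π) (hex : Function.Exact ι π) :
    Module.Projective R N := by
  obtain ⟨m, f, hf, hproj⟩ := hpd
  have : Module.Projective R (LinearMap.ker f) := hproj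
  obtain ⟨α, hα⟩ := Module.projective_lifting_property f π hf
  obtain ⟨β, hβ⟩ := Module.projective_lifting_property π f hπ
  have hα' : ∀ x, f (α x) = π x := LinearMap.congr_fun hα
  have hβ' : ∀ x, π (β x) = f x := LinearMap.congr_fun hβ
  let e : N ≃ₗ[R] LinearMap.ker π := (LinearEquiv.ofInjective ι hι).trans
    (LinearEquiv.ofEq _ _ hex.linearMap_ker_eq.symm)
  have : Module.Projective R (LinearMap.ker π) := by
    let i : LinearMap.ker π →ₗ[R] LinearMap.ker f × (Fin k → R) :=
      LinearMap.prod ((α ∘ₗ (LinearMap.ker π).subtype).codRestrict _ fun x => by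
        simp [hα']) (LinearMap.ker π).subtype
    let r : LinearMap.ker f × (Fin k → R) →ₗ[R] LinearMap.ker π :=
      (LinearMap.coprod (β ∘ₗ (LinearMap.ker f).subtype)
        (LinearMap.id - β ∘ₗ α)).codRestrict _ fun x => by
          simp [hα', hβ']
    refine Module.Projective.of_split i r ?_
    ext x : 2
    change β (α x) + ((x : Fin k → R) - β (α x)) = x
    abel
  exact Module.Projective.of_equiv e.symm

/-- A finitely generated `S`-torsion module is annihilated by an element of `S`. -/
lemma STorsion.exists_smul_eq_zero {S : Submonoid R} {P : Type} [AddCommGroup P] [Module R P]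
    [Module.Finite R P] (h : STorsion R S P) : ∃ t ∈ S, ∀ x : P, t • x = 0 := by
  obtain ⟨n, ψ, hψ⟩ := Module.Finite.exists_fin' R P
  choose s hs hs' using fun j : Fin n => h (ψ (Pi.single j 1))
  refine ⟨∏ j, s j, S.prod_mem fun j _ => hs j, fun x => ?_⟩
  obtain ⟨y, rfl⟩ := hψ x
  have : (∏ j, s j) • ψ = 0 := by
    refine LinearMap.pi_ext' fun i => LinearMap.ext_ring ?_
    obtain ⟨a, ha⟩ := Finset.dvd_prod_of_mem s (Finset.mem_univ i)
    simp [ha, mul_comm (s i), mul_smul, hs']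
  exact LinearMap.congr_fun this y

/-- If for each maximal ideal `p` every `x ∈ I` has a multiple `s * x ∈ J` with `s ∉ p`, then
`I ≤ J`. -/
lemma Ideal.le_of_forall_isMaximal_exists_mul_mem {I J : Ideal R}
    (h : ∀ p : Ideal R, p.IsMaximal → ∀ x ∈ I, ∃ s, s ∉ p ∧ s * x ∈ J) : I ≤ J := by
  intro x hx
  by_contra hxJ
  obtain ⟨p, hp, hle⟩ := Ideal.exists_le_maximal (Submodule.colon J {x}) fun htop => hxJ <| by
    have := (Ideal.eq_top_iff_one _).mp htop
    simpa [Submodule.mem_colon_singleton] using this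
  obtain ⟨s, hs, hsx⟩ := h p hp x hx
  exact hs (hle (Submodule.mem_colon_singleton.mpr hsx))

end Presentation

section Presentation

variable {R : Type} [CommRing R]

/-- The comparison of both Fitting ideals with `det (ι ∘ u)`, when `N` is free up to `s`. -/
lemma exists_pow_mul_mem_fittingIdeal {P : Type} [AddCommGroup P] [Module R P]
    {k : ℕ} {N : Type} [AddCommGroup N] [Module R N]
    [Module.Finite R P] [Module.Finite R (N →ₗ[R] R)]
    (ι : N →ₗ[R] (Fin k → R)) (π : (Fin k → R) →ₗ[R] P)
    (hπ : Function.Surjective π) (hex : Function.Exact ι π)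
    (s : R) (u : (Fin k → R) →ₗ[R] N) (v : N →ₗ[R] (Fin k → R))
    (huv : u ∘ₗ v = s • LinearMap.id) (hvu : v ∘ₗ u = s • LinearMap.id) :
    ∃ n : ℕ, (∀ x ∈ fittingIdeal R (ExtOneDualComm R ι), s ^ n * x ∈ fittingIdeal R P) ∧
      ∀ x ∈ fittingIdeal R P, s ^ n * x ∈ fittingIdeal R (ExtOneDualComm R ι) := by
  have huv' : ∀ x, u (v x) = s • x := LinearMap.congr_fun huv
  let B := LinearMap.toMatrix' (ι ∘ₗ u)
  have hB : ∀ x, B.mulVec x = ι (u x) := LinearMap.toMatrix'_mulVec (ι ∘ₗ u)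
  let q := (LinearMap.range (precompDualComm R ι)).mkQ
  let δ := dotProductEquiv R (Fin k)
  have hδ : ∀ y, δ (B.transpose.mulVec y) = δ y ∘ₗ ι ∘ₗ u := fun y => LinearMap.ext fun x => by
    change B.transpose.mulVec y ⬝ᵥ x = y ⬝ᵥ ι (u x)
    rw [Matrix.mulVec_transpose, ← Matrix.dotProduct_mulVec, hB]
  let φ : (Fin k → R) →ₗ[R] ExtOneDualComm R ι :=
    q ∘ₗ LinearMap.lcomp R R v ∘ₗ δ.toLinearMap
  have hφ_apply : ∀ x, φ x = q (δ x ∘ₗ v) := fun _ => rfl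
  have hq : ∀ g : N →ₗ[R] R, q g = 0 ↔ ∃ f : (Fin k → R) →ₗ[R] R, f ∘ₗ ι = g := fun g => by
    rw [Submodule.mkQ_apply, Submodule.Quotient.mk_eq_zero]
    rfl
  have hφ : ∀ m, ∃ x, φ x = s • m := fun m => by
    obtain ⟨g, rfl⟩ := Submodule.mkQ_surjective _ m
    refine ⟨δ.symm (g ∘ₗ u), ?_⟩
    rw [hφ_apply, LinearEquiv.apply_symm_apply, LinearMap.comp_assoc, huv, ← map_smul]
    congr 1
    ext x
    simp
  have hφrel : ∀ x, φ x = 0 → ∃ y, s • x = B.transpose.mulVec y := fun x hx => by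
    obtain ⟨f, hf⟩ := (hq (δ x ∘ₗ v)).mp hx
    refine ⟨δ.symm f, δ.injective ?_⟩
    rw [hδ, LinearEquiv.apply_symm_apply, ← LinearMap.comp_assoc, hf, LinearMap.comp_assoc, hvu]
    ext x
    simp
  have hφB : ∀ j, φ (B.transpose.col j) = 0 := fun j => by
    rw [hφ_apply, hq, ← Matrix.mulVec_single_one, hδ]
    refine ⟨s • δ (Pi.single j 1), ?_⟩
    rw [LinearMap.comp_assoc, LinearMap.comp_assoc, huv]
    ext x
    simp
  have hπs : ∀ m, ∃ x, π x = s • m := fun m => hπ _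
  have hπrel : ∀ x, π x = 0 → ∃ y, s • x = B.mulVec y := fun x hx => by
    obtain ⟨n, rfl⟩ := (hex x).mp hx
    exact ⟨v n, by rw [hB, huv', map_smul]⟩
  have hπB : ∀ j, π (B.col j) = 0 := fun j => by
    rw [← Matrix.mulVec_single_one, hB]
    exact hex.apply_apply_eq_zero _
  obtain ⟨n₁, hn₁⟩ := exists_pow_mul_det_mem_fittingIdeal π B s hπs hπB
  obtain ⟨n₂, hn₂⟩ := exists_pow_mul_det_mem_fittingIdeal φ B.transpose s hφ hφB
  rw [Matrix.det_transpose] at hn₂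
  refine ⟨n₁ + n₂ + 2 * k, fun x hx => ?_, fun x hx => ?_⟩
  · obtain ⟨a, ha⟩ := Ideal.mem_span_singleton'.mp
      (pow_mul_mem_span_det_of_mem_fittingIdeal φ B.transpose s hφ hφrel hx)
    rw [Matrix.det_transpose] at ha
    have : s ^ (n₁ + n₂ + 2 * k) * x = s ^ n₂ * a * (s ^ n₁ * B.det) := by
      rw [pow_add, mul_assoc, ← ha]
      ring
    rw [this]
    exact Ideal.mul_mem_left _ _ hn₁
  · obtain ⟨a, ha⟩ := Ideal.mem_span_singleton'.mp
      (pow_mul_mem_span_det_of_mem_fittingIdeal π B s hπs hπrel hx)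
    have : s ^ (n₁ + n₂ + 2 * k) * x = s ^ n₁ * a * (s ^ n₂ * B.det) := by
      rw [pow_add, mul_assoc, ← ha]
      ring
    rw [this]
    exact Ideal.mul_mem_left _ _ hn₂

end Presentation

/-- Over a commutative noetherian ring `R` with a multiplicative set
`S` of non-zero-divisors: if `P` is a finitely generated `S`-torsion module with
`pd_R(P) ≤ 1`, then `Fitt_R(Ext^1_R(P, R)) = Fitt_R(P)`, where `Ext^1_R(P, R)` is
computed as the cokernel of `Hom(F, R) → Hom(N, R)` from any presentation
`0 → N → F → P → 0` with `F` finite free. -/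
theorem statement17
    (R : Type) [CommRing R] [IsNoetherianRing R] (S : Submonoid R)
    (hS : S ≤ nonZeroDivisors R)
    (P : Type) [AddCommGroup P] [Module R P]
    (hfg : Module.Finite R P) (htors : STorsion R S P) (hpd : PdLE R 1 P)
    (k : ℕ) (N : Type) [AddCommGroup N] [Module R N]
    (ι : N →ₗ[R] (Fin k → R)) (π : (Fin k → R) →ₗ[R] P)
    (hι : Function.Injective ι) (hπ : Function.Surjective π) (hex : Function.Exact ι π) :
    fittingIdeal R (ExtOneDualComm R ι) = fittingIdeal R P := by
  have hproj : Module.Projective R N := hpd.projective_of_exact ι π hι hπ hex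
  have hNfin : Module.Finite R N := Module.Finite.of_injective ι hι
  have hNfp : Module.FinitePresentation R N := Module.finitePresentation_of_finite R N
  obtain ⟨t, htS, ht⟩ := htors.exists_smul_eq_zero
  have hj : ∀ x, t • x ∈ LinearMap.range ι := fun x => (hex _).mp (by rw [map_smul, ht])
  let j : (Fin k → R) →ₗ[R] N := (LinearEquiv.ofInjective ι hι).symm.toLinearMap ∘ₗ
    (t • LinearMap.id).codRestrict (LinearMap.range ι) hj
  have hιj : ∀ x, ι (j x) = t • x := fun x =>
    congrArg Subtype.val ((LinearEquiv.ofInjective ι hι).apply_symm_apply ⟨t • x, hj x⟩)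
  have hjι : ∀ x, j (ι x) = t • x := fun x => hι (by rw [hιj, map_smul])
  have key : ∀ p : Ideal R, p.IsMaximal → ∃ s, s ∉ p ∧
      (∀ x ∈ fittingIdeal R (ExtOneDualComm R ι), s * x ∈ fittingIdeal R P) ∧
      ∀ x ∈ fittingIdeal R P, s * x ∈ fittingIdeal R (ExtOneDualComm R ι) := by
    intro p hp
    obtain ⟨r, s, u, v, hs, huv, hvu⟩ := exists_notMem_comp_eq_smul_id (N := N) p
    have hrk : r = k := by
      refine eq_of_comp_eq_smul_id (s * t) ?_ (ι ∘ₗ u) (v ∘ₗ j) ?_ ?_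
      · rintro ⟨n, hn⟩
        refine hs ?_
        rw [mul_pow] at hn
        have := (mem_nonZeroDivisors_iff_right.mp (pow_mem (hS htS) n)) _ hn
        exact hp.isPrime.mem_of_pow_mem n (this ▸ p.zero_mem)
      · refine LinearMap.ext fun x => ?_
        have := LinearMap.congr_fun huv (j x)
        simp only [LinearMap.comp_apply, LinearMap.smul_apply, LinearMap.id_apply] at this ⊢
        rw [this, map_smul, hιj, mul_smul]
      · refine LinearMap.ext fun x => ?_
        have := LinearMap.congr_fun hvu x
        simp only [LinearMap.comp_apply, LinearMap.smul_apply, LinearMap.id_apply] at this ⊢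
        rw [hjι, map_smul, this, mul_comm, mul_smul]
    subst hrk
    obtain ⟨n, h₁, h₂⟩ := exists_pow_mul_mem_fittingIdeal ι π hπ hex s u v huv hvu
    exact ⟨s ^ n, fun h => hs (hp.isPrime.mem_of_pow_mem n h), h₁, h₂⟩
  apply le_antisymm <;> refine Ideal.le_of_forall_isMaximal_exists_mul_mem fun p hp x hx => ?_
  · obtain ⟨s, hs, h, -⟩ := key p hp
    exact ⟨s, hs, h x hx⟩
  · obtain ⟨s, hs, -, h⟩ := key p hp
    exact ⟨s, hs, h x hx⟩
end
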